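/- arXiv:1306.6810 — 2 statements merged into one kernel-verified Lean document; each statement's English description precedes it below -/
import Mathlib

section
/- Let n ≥ 2. Suppose g is a pseudo-Riemannian metric of class C^∞ on an open set U ⊆ ℝ^n, ḡ is a pseudo-Riemannian metric of class C^1 on U, and g and ḡ are geodesically related via a continuous 1-form ψ. Then ḡ is of class C^∞ on U. -/
noncomputable section
open scoped BigOperators

/-- Partial derivative `∂_i f` of `f : ℝⁿ → ℝ` in the `i`-th coordinate direction. -/
def pd {n : ℕ} (i : Fin n) (f : (Fin n → ℝ) → ℝ) (x : Fin n → ℝ) : ℝ :=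
  fderiv ℝ f x (Pi.single i 1)

/-- The matrix `(g_{ij}(x))` of a two-index family of functions at a point `x`. -/
def matAt {n : ℕ} (g : Fin n → Fin n → (Fin n → ℝ) → ℝ) (x : Fin n → ℝ) :
    Matrix (Fin n) (Fin n) ℝ := Matrix.of fun i j => g i j x

/-- The components `g^{ij}(x)` of the pointwise inverse matrix. -/
def ginv {n : ℕ} (g : Fin n → Fin n → (Fin n → ℝ) → ℝ) (i j : Fin n) (x : Fin n → ℝ) : ℝ :=
  (matAt g x)⁻¹ i j

/-- `g` is a pseudo-Riemannian metric of class `C^r` on `U`: the components are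
symmetric, of class `C^r`, and the matrix `(g_{ij}(x))` is invertible for every `x ∈ U`. -/
structure IsMetric {n : ℕ} (r : WithTop ℕ∞) (g : Fin n → Fin n → (Fin n → ℝ) → ℝ)
    (U : Set (Fin n → ℝ)) : Prop where
  symm : ∀ i j, ∀ x ∈ U, g i j x = g j i x
  contDiff : ∀ i j, ContDiffOn ℝ r (g i j) U
  inv : ∀ x ∈ U, IsUnit (matAt g x).det

/-- Christoffel symbols `Γ^h_{ij} = (1/2) g^{hk}(∂_i g_{jk} + ∂_j g_{ik} − ∂_k g_{ij})`. -/
def Christoffel {n : ℕ} (g : Fin n → Fin n → (Fin n → ℝ) → ℝ) (h i j : Fin n)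
    (x : Fin n → ℝ) : ℝ :=
  (1/2) * ∑ k, ginv g h k x * (pd i (g j k) x + pd j (g i k) x - pd k (g i j) x)

/-- `g` and `gbar` are geodesically related via the 1-form `ψ`:
`Γ̄^h_{ij} = Γ^h_{ij} + ψ_i δ^h_j + ψ_j δ^h_i` on `U`. -/
def GeodesicallyRelated {n : ℕ} (g gbar : Fin n → Fin n → (Fin n → ℝ) → ℝ)
    (ψ : Fin n → (Fin n → ℝ) → ℝ) (U : Set (Fin n → ℝ)) : Prop :=
  ∀ h i j, ∀ x ∈ U, Christoffel gbar h i j x =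
    Christoffel g h i j x + ψ i x * (if h = j then (1:ℝ) else 0)
      + ψ j x * (if h = i then (1:ℝ) else 0)

open Set Metric MeasureTheory

/-- The derivative in the second variable of a function on `ℝ × E`. -/
noncomputable def fderivSnd {E G : Type*} [NormedAddCommGroup E] [NormedSpace ℝ E]
    [NormedAddCommGroup G] [NormedSpace ℝ G] (H : ℝ × E → G) (z : ℝ × E) : E →L[ℝ] G :=
  (fderiv ℝ H z).comp (ContinuousLinearMap.inr ℝ ℝ E)

section Slice

variable {E G : Type*} [NormedAddCommGroup E] [NormedAddCommGroup G]
  {W : Set (ℝ × E)} {B : Set E} {H : ℝ × E → G}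

theorem exists_bound_near_of_continuousOn [ProperSpace E] (hB : IsOpen B)
    (hBW : ∀ t ∈ Icc (0 : ℝ) 1, ∀ x ∈ B, (t, x) ∈ W) (hH : ContinuousOn H W)
    {x : E} (hx : x ∈ B) :
    ∃ δ > 0, ball x δ ⊆ B ∧ ∃ C, ∀ t ∈ Icc (0 : ℝ) 1, ∀ y ∈ ball x δ, ‖H (t, y)‖ ≤ C := by
  obtain ⟨δ, hδ, hδB⟩ := nhds_basis_closedBall.mem_iff.1 (hB.mem_nhds hx)
  obtain ⟨C, hC⟩ := (isCompact_Icc.prod (isCompact_closedBall x δ)).exists_bound_of_continuousOn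
    (hH.mono fun z hz => hBW z.1 hz.1 z.2 (hδB hz.2))
  exact ⟨δ, hδ, ball_subset_closedBall.trans hδB, C,
    fun t ht y hy => hC (t, y) ⟨ht, ball_subset_closedBall hy⟩⟩

theorem continuousOn_slice (hBW : ∀ t ∈ Icc (0 : ℝ) 1, ∀ x ∈ B, (t, x) ∈ W)
    (hH : ContinuousOn H W) {x : E} (hx : x ∈ B) :
    ContinuousOn (fun t => H (t, x)) (Icc (0 : ℝ) 1) :=
  hH.comp (by fun_prop) fun t ht => hBW t ht x hx

theorem intervalIntegrable_slice (hBW : ∀ t ∈ Icc (0 : ℝ) 1, ∀ x ∈ B, (t, x) ∈ W)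
    (hH : ContinuousOn H W) {x : E} (hx : x ∈ B) :
    IntervalIntegrable (fun t => H (t, x)) volume 0 1 :=
  ((continuousOn_slice hBW hH hx).mono (uIcc_of_le zero_le_one).subset).intervalIntegrable

theorem aestronglyMeasurable_slice (hBW : ∀ t ∈ Icc (0 : ℝ) 1, ∀ x ∈ B, (t, x) ∈ W)
    (hH : ContinuousOn H W) {x : E} (hx : x ∈ B) :
    AEStronglyMeasurable (fun t => H (t, x)) (volume.restrict (uIoc (0 : ℝ) 1)) := by
  have := (intervalIntegrable_slice hBW hH hx).aestronglyMeasurable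
  rwa [uIoc_of_le zero_le_one]

end Slice

section ParametricIntegral

variable {E G : Type*} [NormedAddCommGroup E] [NormedSpace ℝ E]
  [NormedAddCommGroup G] [NormedSpace ℝ G]
  {W : Set (ℝ × E)} {B : Set E} {H : ℝ × E → G}

theorem continuousOn_integral_slice [FiniteDimensional ℝ E] (hB : IsOpen B)
    (hBW : ∀ t ∈ Icc (0 : ℝ) 1, ∀ x ∈ B, (t, x) ∈ W) (hH : ContinuousOn H W) (hW : IsOpen W) :
    ContinuousOn (fun x => ∫ t in (0 : ℝ)..1, H (t, x)) B := by
  intro x hx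
  have : ProperSpace E := FiniteDimensional.proper ℝ E
  obtain ⟨δ, hδ, hδB, C, hC⟩ := exists_bound_near_of_continuousOn hB hBW hH hx
  refine (intervalIntegral.continuousAt_of_dominated_interval (bound := fun _ => C)
    ?_ ?_ intervalIntegrable_const ?_).continuousWithinAt
  · filter_upwards [ball_mem_nhds x hδ] with y hy
    exact aestronglyMeasurable_slice hBW hH (hδB hy)
  · filter_upwards [ball_mem_nhds x hδ] with y hy
    refine Filter.Eventually.of_forall fun t ht => hC t ?_ y hy
    rw [uIoc_of_le zero_le_one] at ht
    exact Ioc_subset_Icc_self ht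
  · refine Filter.Eventually.of_forall fun t ht => ?_
    rw [uIoc_of_le zero_le_one] at ht
    have := (hH.continuousAt (hW.mem_nhds (hBW t (Ioc_subset_Icc_self ht) x hx)))
    exact ContinuousAt.comp (f := fun y : E => (t, y)) this (by fun_prop)

theorem continuousOn_fderivSnd (hW : IsOpen W) (hH : ContDiffOn ℝ 1 H W) :
    ContinuousOn (fderivSnd H) W :=
  (hH.continuousOn_fderiv_of_isOpen hW le_rfl).clm_comp continuousOn_const

theorem ContDiffOn.fderivSnd {m k : WithTop ℕ∞} (hW : IsOpen W) (hH : ContDiffOn ℝ m H W)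
    (hk : k + 1 ≤ m) : ContDiffOn ℝ k (fderivSnd H) W :=
  (hH.fderiv_of_isOpen hW hk).clm_comp contDiffOn_const

theorem hasFDerivAt_slice (hW : IsOpen W) (hH : ContDiffOn ℝ 1 H W) {t : ℝ} {x : E}
    (h : (t, x) ∈ W) : HasFDerivAt (fun y => H (t, y)) (fderivSnd H (t, x)) x :=
  (((hH.differentiableOn one_ne_zero).differentiableAt (hW.mem_nhds h)).hasFDerivAt).comp x
    (hasFDerivAt_prodMk_right t x)

theorem hasFDerivAt_integral_slice [FiniteDimensional ℝ E] (hB : IsOpen B)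
    (hBW : ∀ t ∈ Icc (0 : ℝ) 1, ∀ x ∈ B, (t, x) ∈ W) (hW : IsOpen W) (hH : ContDiffOn ℝ 1 H W)
    {x : E} (hx : x ∈ B) :
    HasFDerivAt (fun x => ∫ t in (0 : ℝ)..1, H (t, x))
      (∫ t in (0 : ℝ)..1, fderivSnd H (t, x)) x := by
  have hD := continuousOn_fderivSnd hW hH
  have : ProperSpace E := FiniteDimensional.proper ℝ E
  obtain ⟨δ, hδ, hδB, C, hC⟩ := exists_bound_near_of_continuousOn hB hBW hD hx
  refine intervalIntegral.hasFDerivAt_integral_of_dominated_of_fderiv_le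
    (bound := fun _ => C) (s := ball x δ) (F' := fun x t => fderivSnd H (t, x)) (ball_mem_nhds x hδ)
    ?_ (intervalIntegrable_slice hBW hH.continuousOn hx) (aestronglyMeasurable_slice hBW hD hx)
    ?_ intervalIntegrable_const ?_
  · filter_upwards [ball_mem_nhds x hδ] with y hy
    exact aestronglyMeasurable_slice hBW hH.continuousOn (hδB hy)
  · refine Filter.Eventually.of_forall fun t ht y hy => hC t ?_ y hy
    rw [uIoc_of_le zero_le_one] at ht
    exact Ioc_subset_Icc_self ht
  · refine Filter.Eventually.of_forall fun t ht y hy => ?_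
    rw [uIoc_of_le zero_le_one] at ht
    exact hasFDerivAt_slice hW hH (hBW t (Ioc_subset_Icc_self ht) y (hδB hy))

end ParametricIntegral

theorem contDiffOn_integral_slice {E : Type} {G : Type} [NormedAddCommGroup E] [NormedSpace ℝ E]
    [FiniteDimensional ℝ E] [NormedAddCommGroup G] [NormedSpace ℝ G]
    {W : Set (ℝ × E)} {B : Set E} {H : ℝ × E → G} (hB : IsOpen B) (hW : IsOpen W)
    (hBW : ∀ t ∈ Icc (0 : ℝ) 1, ∀ x ∈ B, (t, x) ∈ W) (k : ℕ) (hH : ContDiffOn ℝ k H W) :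
    ContDiffOn ℝ k (fun x => ∫ t in (0 : ℝ)..1, H (t, x)) B := by
  induction k generalizing G with
  | zero =>
    simp only [Nat.cast_zero, contDiffOn_zero] at hH ⊢
    exact continuousOn_integral_slice hB hBW hH hW
  | succ k ih =>
    have h1 : ContDiffOn ℝ 1 H W := hH.of_le (by norm_cast; omega)
    have hd := fun x hx => hasFDerivAt_integral_slice hB hBW hW h1 (x := x) hx
    push_cast
    rw [contDiffOn_succ_iff_fderiv_of_isOpen hB]
    refine ⟨fun x hx => (hd x hx).differentiableAt.differentiableWithinAt, by simp, ?_⟩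
    exact (ih (hH.fderivSnd hW (by norm_cast))).congr fun x hx => (hd x hx).fderiv

/-- The pairs `(t, x)` with `x` and `p + t (x - p)` in the ball of radius `R` around `0`. -/
def lineDomain {E : Type*} [NormedAddCommGroup E] [NormedSpace ℝ E] (p : E) (R : ℝ) :
    Set (ℝ × E) :=
  {z | z.2 ∈ ball (0 : E) R ∧ p + z.1 • (z.2 - p) ∈ ball (0 : E) R}

/-- The operator `u ↦ ∑ i, ∫₀¹ K i (t, x) (u (p i + t (x - p i))) dt`, which integrates `u` against
the kernel `K i` along the segments that join the points `p i` to `x`. -/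
noncomputable def lineOp {ι E F G : Type*} [Fintype ι] [NormedAddCommGroup E] [NormedSpace ℝ E]
    [NormedAddCommGroup F] [NormedSpace ℝ F] [NormedAddCommGroup G] [NormedSpace ℝ G]
    (p : ι → E) (K : ι → ℝ × E → F →L[ℝ] G) (u : E → F) (x : E) : G :=
  ∑ i, ∫ t in (0 : ℝ)..1, K i (t, x) (u (p i + t • (x - p i)))

section LineOp

variable {ι E F G : Type} [NormedAddCommGroup E] [NormedSpace ℝ E]
  [NormedAddCommGroup F] [NormedSpace ℝ F] [NormedAddCommGroup G] [NormedSpace ℝ G]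
  {p : ι → E} {K : ι → ℝ × E → F →L[ℝ] G} {u v : E → F} {R r : ℝ}

theorem isOpen_lineDomain (q : E) : IsOpen (lineDomain q R) :=
  (isOpen_ball.preimage continuous_snd).inter
    (isOpen_ball.preimage (f := fun z : ℝ × E => q + z.1 • (z.2 - q)) (by fun_prop))

theorem mem_lineDomain {q : E} (hq : q ∈ ball (0 : E) R) :
    ∀ t ∈ Icc (0 : ℝ) 1, ∀ x ∈ ball (0 : E) R, (t, x) ∈ lineDomain q R :=
  fun _ ht _ hx => ⟨hx, (convex_ball 0 R).add_smul_sub_mem hq hx ht⟩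

theorem contDiffOn_lineOp_integrand {q : E} {m : WithTop ℕ∞} {k : ℝ × E → F →L[ℝ] G}
    (hk : ContDiffOn ℝ m k (lineDomain q R)) (hu : ContDiffOn ℝ m u (ball 0 R)) :
    ContDiffOn ℝ m (fun z : ℝ × E => k z (u (q + z.1 • (z.2 - q)))) (lineDomain q R) :=
  hk.clm_apply (hu.comp (f := fun z : ℝ × E => q + z.1 • (z.2 - q))
    (ContDiff.contDiffOn (by fun_prop)) fun _ hz => hz.2)

theorem contDiffOn_lineOp [Fintype ι] [FiniteDimensional ℝ E] (hp : ∀ i, p i ∈ ball (0 : E) R) (m : ℕ)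
    (hK : ∀ i, ContDiffOn ℝ m (K i) (lineDomain (p i) R)) (hu : ContDiffOn ℝ m u (ball 0 R)) :
    ContDiffOn ℝ m (lineOp p K u) (ball 0 R) :=
  ContDiffOn.sum fun i _ => contDiffOn_integral_slice isOpen_ball (isOpen_lineDomain (p i))
    (mem_lineDomain (hp i)) m (contDiffOn_lineOp_integrand (hK i) hu)

theorem intervalIntegrable_lineOp (hp : ∀ i, p i ∈ ball (0 : E) R)
    (hK : ∀ i, ContinuousOn (K i) (lineDomain (p i) R)) (hu : ContinuousOn u (ball 0 R))
    {x : E} (hx : x ∈ ball (0 : E) R) (i : ι) :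
    IntervalIntegrable (fun t => K i (t, x) (u (p i + t • (x - p i)))) volume 0 1 :=
  intervalIntegrable_slice (mem_lineDomain (hp i)) (contDiffOn_lineOp_integrand (m := 0)
    (contDiffOn_zero.2 (hK i)) (contDiffOn_zero.2 hu)).continuousOn hx

theorem lineOp_sub [Fintype ι] (hp : ∀ i, p i ∈ ball (0 : E) R)
    (hK : ∀ i, ContinuousOn (K i) (lineDomain (p i) R)) (hu : ContinuousOn u (ball 0 R))
    (hv : ContinuousOn v (ball 0 R)) {x : E} (hx : x ∈ ball (0 : E) R) :
    lineOp p K (u - v) x = lineOp p K u x - lineOp p K v x := by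
  simp only [lineOp, Pi.sub_apply, map_sub, ← Finset.sum_sub_distrib]
  exact Finset.sum_congr rfl fun i _ => intervalIntegral.integral_sub
    (intervalIntegrable_lineOp hp hK hu hx i) (intervalIntegrable_lineOp hp hK hv hx i)

theorem lineOp_congr [Fintype ι] (hp : ∀ i, p i ∈ ball (0 : E) R) (huv : EqOn u v (ball 0 R))
    {x : E} (hx : x ∈ ball (0 : E) R) : lineOp p K u x = lineOp p K v x := by
  refine Finset.sum_congr rfl fun i _ => intervalIntegral.integral_congr fun t ht => ?_
  rw [uIcc_of_le zero_le_one] at ht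
  simp only [huv (mem_lineDomain (hp i) t ht x hx).2]

theorem norm_lineOp_le [Fintype ι] (hp : ∀ i, p i ∈ closedBall (0 : E) r) {κ A : ℝ}
    {x : E} (hx : x ∈ closedBall (0 : E) r) (hK : ∀ i, ∀ t ∈ Icc (0 : ℝ) 1, ‖K i (t, x)‖ ≤ κ)
    (hu : ∀ y ∈ closedBall (0 : E) r, ‖u y‖ ≤ A) :
    ‖lineOp p K u x‖ ≤ Fintype.card ι * κ * A := by
  have h : ∀ i ∈ Finset.univ, ‖∫ t in (0 : ℝ)..1, K i (t, x) (u (p i + t • (x - p i)))‖ ≤ κ * A := by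
    intro i _
    refine (intervalIntegral.norm_integral_le_of_norm_le_const (C := κ * A) fun t ht => ?_).trans
      (by simp)
    rw [uIoc_of_le zero_le_one] at ht
    have ht := Ioc_subset_Icc_self ht
    exact (K i (t, x)).le_of_opNorm_le_of_le (hK i t ht)
      (hu _ ((convex_closedBall 0 r).add_smul_sub_mem (hp i) hx ht))
  refine (norm_sum_le_of_le _ h).trans (le_of_eq ?_)
  simp [mul_assoc]

/-- The kernel that multiplies the derivative of `u` in the derivative of `lineOp p K u`. -/
noncomputable def derivKernel (K : ι → ℝ × E → F →L[ℝ] G) (i : ι) (z : ℝ × E) :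
    (E →L[ℝ] F) →L[ℝ] (E →L[ℝ] G) :=
  ContinuousLinearMap.compL ℝ E F G (z.1 • K i z)

/-- The kernel that multiplies `u` in the derivative of `lineOp p K u`. -/
noncomputable def kernelDeriv (K : ι → ℝ × E → F →L[ℝ] G) (i : ι) (z : ℝ × E) :
    F →L[ℝ] (E →L[ℝ] G) :=
  (fderivSnd (K i) z).flip

theorem contDiffOn_derivKernel {m : WithTop ℕ∞} {S : Set (ℝ × E)} {i : ι}
    (hK : ContDiffOn ℝ m (K i) S) : ContDiffOn ℝ m (derivKernel K i) S := by
  have h : ContDiff ℝ m fun A : F →L[ℝ] G => ContinuousLinearMap.compL ℝ E F G A :=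
    ContinuousLinearMap.contDiff _
  exact h.comp_contDiffOn (contDiffOn_fst.smul hK)

theorem contDiffOn_kernelDeriv {m k : WithTop ℕ∞} {S : Set (ℝ × E)} (hS : IsOpen S) {i : ι}
    (hK : ContDiffOn ℝ m (K i) S) (hk : k + 1 ≤ m) : ContDiffOn ℝ k (kernelDeriv K i) S := by
  have h : ContDiff ℝ k (ContinuousLinearMap.flipₗᵢ ℝ E F G) := LinearIsometryEquiv.contDiff _
  rw [ContinuousLinearMap.coe_flipₗᵢ] at h
  exact h.comp_contDiffOn (hK.fderivSnd hS hk)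

theorem norm_derivKernel_le {i : ι} {t : ℝ} (ht : t ∈ Icc (0 : ℝ) 1) (x : E) :
    ‖derivKernel K i (t, x)‖ ≤ ‖K i (t, x)‖ := by
  refine ContinuousLinearMap.opNorm_le_bound _ (norm_nonneg _) fun w => ?_
  have h1 : ‖(K i (t, x)).comp w‖ ≤ ‖K i (t, x)‖ * ‖w‖ := ContinuousLinearMap.opNorm_comp_le _ _
  have h2 : ‖derivKernel K i (t, x) w‖ = t * ‖(K i (t, x)).comp w‖ := by
    simp [derivKernel, norm_smul, abs_of_nonneg ht.1]
  rw [h2]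
  exact (mul_le_of_le_one_left (norm_nonneg _) ht.2).trans h1

theorem hasFDerivAt_lineOp [Fintype ι] [FiniteDimensional ℝ E] (hp : ∀ i, p i ∈ ball (0 : E) R)
    (hK : ∀ i, ContDiffOn ℝ 1 (K i) (lineDomain (p i) R)) (hu : ContDiffOn ℝ 1 u (ball 0 R))
    {x : E} (hx : x ∈ ball (0 : E) R) :
    HasFDerivAt (lineOp p K u)
      (lineOp p (kernelDeriv K) u x + lineOp p (derivKernel K) (fderiv ℝ u) x) x := by
  have hfu : ContinuousOn (fderiv ℝ u) (ball 0 R) :=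
    hu.continuousOn_fderiv_of_isOpen isOpen_ball le_rfl
  simp only [lineOp, ← Finset.sum_add_distrib]
  refine HasFDerivAt.fun_sum fun i _ => ?_
  have hW := isOpen_lineDomain (R := R) (p i)
  have hBW := mem_lineDomain (hp i)
  convert hasFDerivAt_integral_slice isOpen_ball hBW hW
    (contDiffOn_lineOp_integrand (hK i) hu) hx using 1
  rw [← intervalIntegral.integral_add]
  · refine intervalIntegral.integral_congr fun t ht => ?_
    rw [uIcc_of_le zero_le_one] at ht
    have hz := hBW t ht x hx
    have hφ : HasFDerivAt (fun y : E => p i + t • (y - p i)) (t • ContinuousLinearMap.id ℝ E) x :=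
      (((hasFDerivAt_id x).sub_const (p i)).const_smul t).const_add (p i)
    have hu' := ((hu.differentiableOn one_ne_zero).differentiableAt
      (isOpen_ball.mem_nhds hz.2)).hasFDerivAt
    have h1 := (hasFDerivAt_slice hW (hK i) hz).clm_apply (hu'.comp x hφ)
    have h2 := hasFDerivAt_slice hW (contDiffOn_lineOp_integrand (hK i) hu) hz
    rw [← h1.unique h2]
    ext w
    simp [kernelDeriv, derivKernel, add_comm]
  · exact intervalIntegrable_lineOp hp (fun i => (contDiffOn_kernelDeriv
      (isOpen_lineDomain _) (hK i) (by simp)).continuousOn (n := 0)) hu.continuousOn hx i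
  · exact intervalIntegrable_lineOp hp (fun i => (contDiffOn_derivKernel (hK i)).continuousOn)
      hfu hx i

end LineOp

section Regularity

variable {ι E F : Type} [Fintype ι] [NormedAddCommGroup E] [NormedSpace ℝ E]
  [NormedAddCommGroup F] [NormedSpace ℝ F] {p : ι → E} {K : ι → ℝ × E → F →L[ℝ] F} {u s : E → F} {R r κ : ℝ}

/-- The `j`-th term of the Neumann series that solves `u = s + lineOp p K u`. -/
noncomputable def neumannTerm (p : ι → E) (K : ι → ℝ × E → F →L[ℝ] F) (s : E → F) : ℕ → E → F
  | 0 => s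
  | j + 1 => lineOp p K (neumannTerm p K s j)

theorem norm_neumannTerm_le (hp : ∀ i, p i ∈ closedBall (0 : E) r)
    (hK : ∀ i, ∀ t ∈ Icc (0 : ℝ) 1, ∀ x ∈ closedBall (0 : E) r, ‖K i (t, x)‖ ≤ κ)
    (hκ : Fintype.card ι * κ ≤ 1 / 2) {A : ℝ} (hA : 0 ≤ A)
    (hs : ∀ y ∈ closedBall (0 : E) r, ‖s y‖ ≤ A) (j : ℕ) :
    ∀ x ∈ closedBall (0 : E) r, ‖neumannTerm p K s j x‖ ≤ A * (1 / 2) ^ j := by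
  induction j with
  | zero => simpa [neumannTerm] using hs
  | succ j ih =>
    intro x hx
    refine (norm_lineOp_le hp hx (fun i t ht => hK i t ht x hx) ih).trans ?_
    refine (mul_le_mul_of_nonneg_right hκ (by positivity)).trans (le_of_eq ?_)
    ring

variable [FiniteDimensional ℝ E]

theorem contDiffOn_neumannTerm (hp : ∀ i, p i ∈ ball (0 : E) R) {m : ℕ}
    (hK : ∀ i, ContDiffOn ℝ m (K i) (lineDomain (p i) R)) (hs : ContDiffOn ℝ m s (ball 0 R))
    (j : ℕ) : ContDiffOn ℝ m (neumannTerm p K s j) (ball 0 R) := by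
  induction j with
  | zero => exact hs
  | succ j ih => exact contDiffOn_lineOp hp m hK ih

/-- A continuous solution of `u = s + lineOp p K u` is the sum of its Neumann series. -/
theorem hasSum_neumannTerm (hp : ∀ i, p i ∈ closedBall (0 : E) r) (hrR : r < R)
    (hKc : ∀ i, ContinuousOn (K i) (lineDomain (p i) R))
    (hK : ∀ i, ∀ t ∈ Icc (0 : ℝ) 1, ∀ x ∈ closedBall (0 : E) r, ‖K i (t, x)‖ ≤ κ)
    (hκ : Fintype.card ι * κ ≤ 1 / 2) (hs : ContinuousOn s (ball 0 R))
    (hu : ContinuousOn u (ball 0 R)) (hus : ∀ x ∈ ball (0 : E) R, u x = s x + lineOp p K u x) :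
    ∀ x ∈ closedBall (0 : E) r, HasSum (fun j => neumannTerm p K s j x) (u x) := by
  have : ProperSpace E := FiniteDimensional.proper ℝ E
  have hp' : ∀ i, p i ∈ ball (0 : E) R := fun i => closedBall_subset_ball hrR (hp i)
  have hec : ∀ j, ContinuousOn (neumannTerm p K s j) (ball 0 R) := fun j =>
    (contDiffOn_neumannTerm (m := 0) hp' (fun i => contDiffOn_zero.2 (hKc i))
      (contDiffOn_zero.2 hs) j).continuousOn
  have hsum : ∀ N, ∀ x ∈ ball (0 : E) R,
      u x = ∑ j ∈ Finset.range N, neumannTerm p K s j x + neumannTerm p K u N x := by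
    have hstep : ∀ N, ∀ x ∈ ball (0 : E) R,
        neumannTerm p K u N x = neumannTerm p K s N x + neumannTerm p K u (N + 1) x := by
      intro N
      induction N with
      | zero => exact hus
      | succ N ih =>
        intro x hx
        have huc : ∀ j, ContinuousOn (neumannTerm p K u j) (ball 0 R) := fun j =>
          (contDiffOn_neumannTerm (m := 0) hp' (fun i => contDiffOn_zero.2 (hKc i))
            (contDiffOn_zero.2 hu) j).continuousOn
        have h : lineOp p K (neumannTerm p K u (N + 1)) x
            = lineOp p K (neumannTerm p K u N - neumannTerm p K s N) x :=
          lineOp_congr hp' (fun y hy => by simp [ih y hy]) hx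
        rw [lineOp_sub hp' hKc (huc N) (hec N) hx] at h
        change lineOp p K (neumannTerm p K u N) x = lineOp p K (neumannTerm p K s N) x
          + lineOp p K (neumannTerm p K u (N + 1)) x
        rw [h]
        abel
    intro N
    induction N with
    | zero => intro x _; simp [neumannTerm]
    | succ N ih =>
      intro x hx
      rw [ih x hx, Finset.sum_range_succ, hstep N x hx, add_assoc]
  obtain ⟨A, hA⟩ := (isCompact_closedBall (0 : E) r).exists_bound_of_continuousOn
    (hu.mono (closedBall_subset_ball hrR))
  obtain ⟨A', hA'⟩ := (isCompact_closedBall (0 : E) r).exists_bound_of_continuousOn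
    (hs.mono (closedBall_subset_ball hrR))
  intro x hx
  have hA0 : 0 ≤ A := (norm_nonneg _).trans (hA x hx)
  have hA0' : 0 ≤ A' := (norm_nonneg _).trans (hA' x hx)
  have hgeo : Summable fun j : ℕ => ‖neumannTerm p K s j x‖ :=
    Summable.of_nonneg_of_le (fun _ => norm_nonneg _)
      (fun j => norm_neumannTerm_le hp hK hκ hA0' hA' j x hx)
      (summable_geometric_two.mul_left A')
  rw [hasSum_iff_tendsto_nat_of_summable_norm hgeo, tendsto_iff_norm_sub_tendsto_zero]
  refine squeeze_zero (fun _ => norm_nonneg _) (g := fun N => A * (1 / 2) ^ N) (fun N => ?_) ?_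
  · rw [norm_sub_rev]
    nth_rewrite 1 [hsum N x (closedBall_subset_ball hrR hx)]
    rw [add_sub_cancel_left]
    exact norm_neumannTerm_le hp hK hκ hA0 hA N x hx
  · simpa using (tendsto_pow_atTop_nhds_zero_of_lt_one (r := (1 / 2 : ℝ)) (by norm_num)
      (by norm_num)).const_mul A

theorem exists_bound_kernel {G : Type} [NormedAddCommGroup G] {q : E} {k : ℝ × E → G}
    (hq : q ∈ closedBall (0 : E) r) (hrR : r < R) (hk : ContinuousOn k (lineDomain q R)) :
    ∃ C, ∀ t ∈ Icc (0 : ℝ) 1, ∀ x ∈ closedBall (0 : E) r, ‖k (t, x)‖ ≤ C := by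
  have : ProperSpace E := FiniteDimensional.proper ℝ E
  obtain ⟨C, hC⟩ := (isCompact_Icc.prod (isCompact_closedBall (0 : E) r)).exists_bound_of_continuousOn
    (hk.mono fun z hz => mem_lineDomain (closedBall_subset_ball hrR hq) z.1 hz.1 z.2
      (closedBall_subset_ball hrR hz.2))
  exact ⟨C, fun t ht x hx => hC (t, x) ⟨ht, hx⟩⟩

/-- The derivatives of the terms of the Neumann series are dominated by a convergent series. -/
theorem exists_summable_bound_fderiv_neumannTerm (hp : ∀ i, p i ∈ closedBall (0 : E) r)
    (hrR : r < R) (hKc : ∀ i, ContDiffOn ℝ 1 (K i) (lineDomain (p i) R))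
    (hK : ∀ i, ∀ t ∈ Icc (0 : ℝ) 1, ∀ x ∈ closedBall (0 : E) r, ‖K i (t, x)‖ ≤ κ)
    (hκ : Fintype.card ι * κ ≤ 1 / 2) (hs : ContDiffOn ℝ 1 s (ball 0 R)) :
    ∃ v : ℕ → ℝ, Summable v ∧
      ∀ j, ∀ x ∈ closedBall (0 : E) r, ‖fderiv ℝ (neumannTerm p K s j) x‖ ≤ v j := by
  have : ProperSpace E := FiniteDimensional.proper ℝ E
  have hp' : ∀ i, p i ∈ ball (0 : E) R := fun i => closedBall_subset_ball hrR (hp i)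
  choose C hC using fun i => exists_bound_kernel (hp i) hrR
    (contDiffOn_kernelDeriv (k := 0) (isOpen_lineDomain (p i)) (hKc i) (by simp)).continuousOn
  obtain ⟨A, hA⟩ := (isCompact_closedBall (0 : E) r).exists_bound_of_continuousOn
    (hs.continuousOn.mono (closedBall_subset_ball hrR))
  obtain ⟨A', hA'⟩ := (isCompact_closedBall (0 : E) r).exists_bound_of_continuousOn
    ((hs.continuousOn_fderiv_of_isOpen isOpen_ball le_rfl).mono (closedBall_subset_ball hrR))
  set C₀ := ∑ i, |C i| with hC₀
  have hCC₀ : ∀ i, C i ≤ C₀ := fun i => (le_abs_self _).trans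
    (Finset.single_le_sum (f := fun i => |C i|) (fun _ _ => abs_nonneg _) (Finset.mem_univ i))
  have hC₀0 : 0 ≤ C₀ := Finset.sum_nonneg fun _ _ => abs_nonneg _
  set c : ℝ := Fintype.card ι * C₀
  refine ⟨fun j => (|A'| + 2 * c * |A| * j) * (1 / 2) ^ j, ?_, fun j => ?_⟩
  · have h0 : Summable fun j : ℕ => |A'| * (1 / 2 : ℝ) ^ j := summable_geometric_two.mul_left _
    have h1 : Summable fun j : ℕ => 2 * c * |A| * ((j : ℝ) ^ 1 * (1 / 2 : ℝ) ^ j) :=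
      (summable_pow_mul_geometric_of_norm_lt_one 1 (r := (1 / 2 : ℝ)) (by norm_num)).mul_left _
    refine (h0.add h1).congr fun j => ?_
    ring
  · induction j with
    | zero =>
      intro x hx
      simpa [neumannTerm] using (hA' x hx).trans (le_abs_self _)
    | succ j ih =>
      intro x hx
      have hd := hasFDerivAt_lineOp hp' hKc (contDiffOn_neumannTerm (m := 1) hp' (by exact_mod_cast hKc)
        (by exact_mod_cast hs) j) (closedBall_subset_ball hrR hx)
      change ‖fderiv ℝ (lineOp p K (neumannTerm p K s j)) x‖ ≤ _
      rw [hd.fderiv]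
      have h1 := norm_lineOp_le hp hx (fun i t ht => (hC i t ht x hx).trans (hCC₀ i))
        (norm_neumannTerm_le hp hK hκ (abs_nonneg A)
          (fun y hy => (hA y hy).trans (le_abs_self A)) j)
      have h2 := norm_lineOp_le hp hx
        (fun i t ht => (norm_derivKernel_le ht x).trans (hK i t ht x hx)) ih
      refine (norm_add_le_of_le h1 (h2.trans
        (mul_le_mul_of_nonneg_right hκ (by positivity)))).trans (le_of_eq ?_)
      push_cast
      ring

theorem contDiffOn_one_of_eq_add_lineOp [CompleteSpace F]
    (hp : ∀ i, p i ∈ closedBall (0 : E) r) (hrR : r < R)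
    (hKc : ∀ i, ContDiffOn ℝ 1 (K i) (lineDomain (p i) R))
    (hK : ∀ i, ∀ t ∈ Icc (0 : ℝ) 1, ∀ x ∈ ball (0 : E) R, ‖K i (t, x)‖ ≤ κ)
    (hκ : Fintype.card ι * κ ≤ 1 / 2) (hs : ContDiffOn ℝ 1 s (ball 0 R))
    (hu : ContinuousOn u (ball 0 R)) (hus : ∀ x ∈ ball (0 : E) R, u x = s x + lineOp p K u x) :
    ContDiffOn ℝ 1 u (ball 0 R) := by
  have hp' : ∀ i, p i ∈ ball (0 : E) R := fun i => closedBall_subset_ball hrR (hp i)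
  have hec := fun j => contDiffOn_neumannTerm (m := 1) hp' (by exact_mod_cast hKc)
    (by exact_mod_cast hs : ContDiffOn ℝ (1 : ℕ) s (ball 0 R)) j
  intro x₀ hx₀
  obtain ⟨ρ, hρ, hρR⟩ := exists_between (max_lt hrR (mem_ball_zero_iff.1 hx₀))
  have hpρ : ∀ i, p i ∈ closedBall (0 : E) ρ := fun i =>
    closedBall_subset_closedBall ((le_max_left _ _).trans hρ.le) (hp i)
  have hKρ : ∀ i, ∀ t ∈ Icc (0 : ℝ) 1, ∀ x ∈ closedBall (0 : E) ρ, ‖K i (t, x)‖ ≤ κ :=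
    fun i t ht x hx => hK i t ht x (closedBall_subset_ball hρR hx)
  have hsum := hasSum_neumannTerm hpρ hρR (fun i => (hKc i).continuousOn) hKρ hκ
    hs.continuousOn hu hus
  obtain ⟨v, hv, hev⟩ := exists_summable_bound_fderiv_neumannTerm hpρ hρR hKc hKρ hκ hs
  have hx₀ρ : x₀ ∈ ball (0 : E) ρ := mem_ball_zero_iff.2 ((le_max_right _ _).trans_lt hρ)
  have hsub : ball (0 : E) ρ ⊆ ball 0 R := ball_subset_ball hρR.le
  have hd : ∀ x ∈ ball (0 : E) ρ,
      HasFDerivAt u (∑' j, fderiv ℝ (neumannTerm p K s j) x) x := by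
    intro x hx
    refine (hasFDerivAt_tsum_of_isPreconnected hv isOpen_ball (convex_ball 0 ρ).isPreconnected
      (fun j y hy => (((hec j).differentiableOn (by simp)).differentiableAt
        (isOpen_ball.mem_nhds (hsub hy))).hasFDerivAt)
      (fun j y hy => hev j y (ball_subset_closedBall hy)) hx
      (hsum x (ball_subset_closedBall hx)).summable hx).congr_of_eventuallyEq ?_
    filter_upwards [isOpen_ball.mem_nhds hx] with y hy
    exact (hsum y (ball_subset_closedBall hy)).tsum_eq.symm
  have hcont : ContinuousOn (fun x => ∑' j, fderiv ℝ (neumannTerm p K s j) x) (ball 0 ρ) :=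
    continuousOn_tsum (fun j => ((hec j).continuousOn_fderiv_of_isOpen isOpen_ball
      (by simp)).mono hsub) hv fun j x hx => hev j x (ball_subset_closedBall hx)
  have h1 : ContDiffOn ℝ (0 + 1) u (ball 0 ρ) := by
    rw [contDiffOn_succ_iff_fderiv_of_isOpen isOpen_ball]
    refine ⟨fun x hx => (hd x hx).differentiableAt.differentiableWithinAt, by simp, ?_⟩
    exact contDiffOn_zero.2 (hcont.congr fun x hx => (hd x hx).fderiv)
  rw [zero_add] at h1
  exact (h1.contDiffAt (isOpen_ball.mem_nhds hx₀ρ)).contDiffWithinAt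

end Regularity

/-- Interior regularity for `u = s + lineOp p K u` with a smooth kernel of small norm: a continuous
solution `u` is as smooth as `s`. -/
theorem contDiffOn_of_eq_add_lineOp {ι E F : Type} [Fintype ι] [NormedAddCommGroup E]
    [NormedSpace ℝ E] [FiniteDimensional ℝ E] [NormedAddCommGroup F] [NormedSpace ℝ F]
    [CompleteSpace F] {p : ι → E} {K : ι → ℝ × E → F →L[ℝ] F} {u s : E → F} {R r κ : ℝ}
    (hp : ∀ i, p i ∈ closedBall (0 : E) r) (hrR : r < R)
    (hKc : ∀ i, ContDiffOn ℝ ((⊤ : ℕ∞) : WithTop ℕ∞) (K i) (lineDomain (p i) R))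
    (hK : ∀ i, ∀ t ∈ Icc (0 : ℝ) 1, ∀ x ∈ ball (0 : E) R, ‖K i (t, x)‖ ≤ κ)
    (hκ : Fintype.card ι * κ ≤ 1 / 2) (hu : ContinuousOn u (ball 0 R))
    (hus : ∀ x ∈ ball (0 : E) R, u x = s x + lineOp p K u x)
    (m : ℕ) (hs : ContDiffOn ℝ m s (ball 0 R)) :
    ContDiffOn ℝ m u (ball 0 R) := by
  induction m generalizing F with
  | zero => exact contDiffOn_zero.2 hu
  | succ m ih =>
    have hp' : ∀ i, p i ∈ ball (0 : E) R := fun i => closedBall_subset_ball hrR (hp i)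
    have hKn : ∀ k : ℕ, ∀ i, ContDiffOn ℝ k (K i) (lineDomain (p i) R) := fun k i =>
      (hKc i).of_le (by exact_mod_cast le_top)
    have hK1 : ∀ i, ContDiffOn ℝ 1 (K i) (lineDomain (p i) R) := by exact_mod_cast hKn 1
    have hs1 : ContDiffOn ℝ 1 s (ball 0 R) := hs.of_le (by norm_cast; omega)
    have hu1 := contDiffOn_one_of_eq_add_lineOp hp hrR hK1 hK hκ hs1 hu hus
    have hum : ContDiffOn ℝ m u (ball 0 R) :=
      ih hKc hK hu hus (hs.of_le (by norm_cast; omega))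
    have hdu : ∀ x ∈ ball (0 : E) R, fderiv ℝ u x
        = (fderiv ℝ s x + lineOp p (kernelDeriv K) u x)
          + lineOp p (derivKernel K) (fderiv ℝ u) x := by
      intro x hx
      have h := (((hs1.differentiableOn one_ne_zero).differentiableAt
        (isOpen_ball.mem_nhds hx)).hasFDerivAt).add (hasFDerivAt_lineOp hp' hK1 hu1 hx)
      rw [add_assoc, ← h.fderiv]
      refine Filter.EventuallyEq.fderiv_eq ?_
      filter_upwards [isOpen_ball.mem_nhds hx] with y hy
      exact hus y hy
    push_cast at hs ⊢
    rw [contDiffOn_succ_iff_fderiv_of_isOpen isOpen_ball]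
    refine ⟨hu1.differentiableOn one_ne_zero, by simp, ?_⟩
    refine ih (fun i => contDiffOn_derivKernel (hKc i))
      (fun i t ht x hx => (norm_derivKernel_le ht x).trans (hK i t ht x hx))
      (hu1.continuousOn_fderiv_of_isOpen isOpen_ball le_rfl) hdu
      ((hs.fderiv_of_isOpen isOpen_ball le_rfl).add (contDiffOn_lineOp hp' m
        (fun i => contDiffOn_kernelDeriv (isOpen_lineDomain _) (hKn (m + 1) i) (by norm_cast)) hum))

section Killing

variable {n : ℕ}

/-- The quadratic form `v ↦ B(v, v)`. -/
def quadForm (B : Fin n → Fin n → ℝ) (v : Fin n → ℝ) : ℝ :=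
  ∑ i, ∑ j, B i j * (v i * v j)

/-- The points `0`, `e i`, `e j`, `e i + e j`, indexed by `(i, j, c, d)` with `c, d ∈ {0, 1}`. -/
def vertex (m : Fin n × Fin n × Fin 2 × Fin 2) : Fin n → ℝ :=
  Pi.single m.1 ((m.2.2.1 : ℕ) : ℝ) + Pi.single m.2.1 ((m.2.2.2 : ℕ) : ℝ)

/-- The half of the sign with which a vertex enters a second difference. -/
noncomputable def vertexWeight (m : Fin n × Fin n × Fin 2 × Fin 2) : ℝ :=
  (-1) ^ ((m.2.2.1 : ℕ) + (m.2.2.2 : ℕ)) / 2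

/-- The elementary matrix `E i j` of the index `(i, j, c, d)`. -/
def vertexMatrix (m : Fin n × Fin n × Fin 2 × Fin 2) : Fin n → Fin n → ℝ :=
  Pi.single m.1 (Pi.single m.2.1 1)

theorem norm_vertex_le (m : Fin n × Fin n × Fin 2 × Fin 2) : ‖vertex m‖ ≤ 2 := by
  have h : ∀ (i : Fin n) (c : Fin 2), ‖(Pi.single i ((c : ℕ) : ℝ) : Fin n → ℝ)‖ ≤ 1 := by
    intro i c
    rw [Pi.norm_single, Real.norm_natCast]
    exact_mod_cast Nat.lt_succ_iff.1 c.isLt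
  exact (norm_add_le_of_le (h _ _) (h _ _)).trans (by norm_num)

theorem norm_vertexMatrix (m : Fin n × Fin n × Fin 2 × Fin 2) : ‖vertexMatrix m‖ = 1 := by
  rw [vertexMatrix, Pi.norm_single, Pi.norm_single, norm_one]

theorem quadForm_eq_dotProduct (B : Fin n → Fin n → ℝ) (v : Fin n → ℝ) :
    quadForm B v = v ⬝ᵥ (Matrix.of B).mulVec v := by
  simp only [quadForm, dotProduct, Matrix.mulVec, Matrix.of_apply, Finset.mul_sum]
  exact Finset.sum_congr rfl fun i _ => Finset.sum_congr rfl fun j _ => by ring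

/-- A symmetric matrix is recovered from the values of its quadratic form at the vectors from the
vertices to an arbitrary point. -/
theorem sum_vertexWeight_quadForm {B : Fin n → Fin n → ℝ} (hB : ∀ i j, B i j = B j i)
    (x : Fin n → ℝ) :
    ∑ m, (vertexWeight m * quadForm B (x - vertex m)) • vertexMatrix m = B := by
  have key : ∀ i j, ∑ c : Fin 2, ∑ d : Fin 2,
      vertexWeight (i, j, c, d) * quadForm B (x - vertex (i, j, c, d)) = B i j := by
    intro i j
    simp only [Fin.sum_univ_two, vertexWeight, vertex, quadForm_eq_dotProduct]
    simp [Matrix.mulVec_sub, Matrix.mulVec_add, sub_dotProduct, add_dotProduct, dotProduct_sub,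
      dotProduct_add, Matrix.mulVec_single, single_dotProduct]
    rw [hB j i]
    ring
  ext a b
  simp only [Fintype.sum_prod_type, Finset.sum_apply, Pi.smul_apply, smul_eq_mul]
  rw [← key a b, Finset.sum_eq_single a, Finset.sum_eq_single b]
  · simp [vertexMatrix]
  · intro j _ hj
    simp [vertexMatrix, hj.symm]
  · simp
  · intro i _ hi
    simp [vertexMatrix, hi.symm]
  · simp

/-- The kernel of the integral equation satisfied by a solution of a Killing type equation with
coefficients `c`. -/
noncomputable def killingKernel (c : Fin n → Fin n → (Fin n → ℝ) × (Fin n → ℝ) → ℝ)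
    (m : Fin n × Fin n × Fin 2 × Fin 2) (z : ℝ × (Fin n → ℝ)) :
    (Fin n → Fin n → ℝ) →L[ℝ] (Fin n → Fin n → ℝ) :=
  ∑ h, ∑ l, (vertexWeight m * c h l (vertex m + z.1 • (z.2 - vertex m), z.2 - vertex m)) •
    (((ContinuousLinearMap.proj (R := ℝ) (φ := fun _ : Fin n => ℝ) l).comp
      (ContinuousLinearMap.proj (R := ℝ) (φ := fun _ : Fin n => Fin n → ℝ) h)).smulRight
        (vertexMatrix m))

theorem killingKernel_apply (c : Fin n → Fin n → (Fin n → ℝ) × (Fin n → ℝ) → ℝ)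
    (m : Fin n × Fin n × Fin 2 × Fin 2) (z : ℝ × (Fin n → ℝ)) (B : Fin n → Fin n → ℝ) :
    killingKernel c m z B = (vertexWeight m * ∑ h, ∑ l,
      c h l (vertex m + z.1 • (z.2 - vertex m), z.2 - vertex m) * B h l) • vertexMatrix m := by
  simp only [killingKernel, sum_apply, smul_apply,
    ContinuousLinearMap.smulRight_apply, ContinuousLinearMap.comp_apply,
    ContinuousLinearMap.proj_apply, smul_smul, Finset.mul_sum, Finset.sum_smul, mul_assoc]

theorem contDiffOn_killingKernel {c : Fin n → Fin n → (Fin n → ℝ) × (Fin n → ℝ) → ℝ}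
    {k : WithTop ℕ∞} {R : ℝ} (hc : ∀ h l, ContDiffOn ℝ k (c h l) (ball 0 R ×ˢ univ))
    (m : Fin n × Fin n × Fin 2 × Fin 2) :
    ContDiffOn ℝ k (killingKernel c m) (lineDomain (vertex m) R) := by
  refine ContDiffOn.sum fun h _ => ContDiffOn.sum fun l _ => ?_
  exact (contDiffOn_const.mul ((hc h l).comp (f := fun z : ℝ × (Fin n → ℝ) =>
    (vertex m + z.1 • (z.2 - vertex m), z.2 - vertex m)) (ContDiff.contDiffOn (by fun_prop))
    fun z hz => ⟨hz.2, mem_univ _⟩)).smul contDiffOn_const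

theorem norm_killingKernel_le {c : Fin n → Fin n → (Fin n → ℝ) × (Fin n → ℝ) → ℝ}
    {κ : ℝ} (hc : ∀ h l, ∀ y ∈ ball (0 : Fin n → ℝ) 3, ∀ v, ‖v‖ ≤ 5 → |c h l (y, v)| ≤ κ)
    (m : Fin n × Fin n × Fin 2 × Fin 2) {t : ℝ} (ht : t ∈ Icc (0 : ℝ) 1) {x : Fin n → ℝ}
    (hx : x ∈ ball (0 : Fin n → ℝ) 3) : ‖killingKernel c m (t, x)‖ ≤ n ^ 2 * κ / 2 := by
  have hv : ‖x - vertex m‖ ≤ 5 :=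
    (norm_sub_le_of_le (mem_ball_zero_iff.1 hx).le (norm_vertex_le m)).trans (by norm_num)
  have hy : vertex m + t • (x - vertex m) ∈ ball (0 : Fin n → ℝ) 3 :=
    (convex_ball 0 3).add_smul_sub_mem
      (mem_ball_zero_iff.2 ((norm_vertex_le m).trans_lt (by norm_num))) hx ht
  have hw : |vertexWeight m| = 1 / 2 := by simp [vertexWeight, abs_div, abs_pow]
  have hterm : ∀ h ∈ Finset.univ, ∀ l ∈ Finset.univ,
      ‖(vertexWeight m * c h l (vertex m + t • (x - vertex m), x - vertex m)) •
      (((ContinuousLinearMap.proj (R := ℝ) (φ := fun _ : Fin n => ℝ) l).comp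
        (ContinuousLinearMap.proj (R := ℝ) (φ := fun _ : Fin n => Fin n → ℝ) h)).smulRight
          (vertexMatrix m))‖ ≤ κ / 2 := by
    intro h _ l _
    have h1 : ‖(((ContinuousLinearMap.proj (R := ℝ) (φ := fun _ : Fin n => ℝ) l).comp
        (ContinuousLinearMap.proj (R := ℝ) (φ := fun _ : Fin n => Fin n → ℝ) h)).smulRight
          (vertexMatrix m))‖ ≤ 1 := by
      refine ContinuousLinearMap.opNorm_le_bound _ zero_le_one fun B => ?_
      simp only [ContinuousLinearMap.smulRight_apply, ContinuousLinearMap.comp_apply,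
        ContinuousLinearMap.proj_apply, norm_smul, norm_vertexMatrix, mul_one, one_mul]
      exact (norm_le_pi_norm (B h) l).trans (norm_le_pi_norm B h)
    rw [norm_smul, norm_mul, Real.norm_eq_abs, Real.norm_eq_abs, hw]
    have h2 := hc h l _ hy _ hv
    refine (mul_le_of_le_one_right (by positivity) h1).trans ?_
    linarith
  refine (norm_sum_le_of_le _ fun h hh => norm_sum_le_of_le _ (hterm h hh)).trans (le_of_eq ?_)
  simp
  ring

/-- Integration along a segment of a solution of a Killing type equation. -/
theorem quadForm_eq_add_integral {b : (Fin n → ℝ) → Fin n → Fin n → ℝ} {S : Set (Fin n → ℝ)}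
    (hS : IsOpen S) (hSc : Convex ℝ S) (hb : ContDiffOn ℝ 1 b S)
    {c : Fin n → Fin n → (Fin n → ℝ) × (Fin n → ℝ) → ℝ}
    (hc : ∀ h l, ContinuousOn (c h l) (S ×ˢ univ))
    (heq : ∀ y ∈ S, ∀ v, quadForm (fderiv ℝ b y v) v = ∑ h, ∑ l, c h l (y, v) * b y h l)
    {q x : Fin n → ℝ} (hq : q ∈ S) (hx : x ∈ S) :
    quadForm (b x) (x - q) = quadForm (b q) (x - q) + ∫ t in (0 : ℝ)..1,
      ∑ h, ∑ l, c h l (q + t • (x - q), x - q) * b (q + t • (x - q)) h l := by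
  have hmem : ∀ t ∈ uIcc (0 : ℝ) 1, q + t • (x - q) ∈ S := fun t ht =>
    hSc.add_smul_sub_mem hq hx (by rwa [uIcc_of_le zero_le_one] at ht)
  have hd : ∀ t ∈ uIcc (0 : ℝ) 1, HasDerivAt (fun t => quadForm (b (q + t • (x - q))) (x - q))
      (∑ h, ∑ l, c h l (q + t • (x - q), x - q) * b (q + t • (x - q)) h l) t := by
    intro t ht
    rw [← heq _ (hmem t ht)]
    have hφ : HasDerivAt (fun t : ℝ => q + t • (x - q)) (x - q) t := by
      simpa using ((hasDerivAt_id t).smul_const (x - q)).const_add q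
    have h := (((hb.differentiableOn one_ne_zero).differentiableAt
      (hS.mem_nhds (hmem t ht))).hasFDerivAt).comp_hasDerivAt t hφ
    refine HasDerivAt.fun_sum fun i _ => HasDerivAt.fun_sum fun j _ => HasDerivAt.mul_const ?_ _
    exact hasDerivAt_pi.1 (hasDerivAt_pi.1 h i) j
  have hcont : ContinuousOn (fun t : ℝ => ∑ h, ∑ l, c h l (q + t • (x - q), x - q) *
      b (q + t • (x - q)) h l) (uIcc 0 1) := by
    refine continuousOn_finsetSum _ fun h _ => continuousOn_finsetSum _ fun l _ => ?_
    refine ContinuousOn.mul ((hc h l).comp (f := fun t : ℝ => (q + t • (x - q), x - q))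
      (by fun_prop) fun t ht => ⟨hmem t ht, mem_univ _⟩) ?_
    exact continuousOn_pi.1 (continuousOn_pi.1 (hb.continuousOn.comp
      (f := fun t : ℝ => q + t • (x - q)) (by fun_prop) hmem) h) l
  rw [intervalIntegral.integral_eq_sub_of_hasDerivAt hd hcont.intervalIntegrable]
  simp

/-- A symmetric `C¹` solution `b` of a Killing type equation `(∂_v b)(v, v) = c(y, v) · b` with
small smooth coefficients `c` is smooth. -/
theorem contDiffOn_of_killing_of_small {b : (Fin n → ℝ) → Fin n → Fin n → ℝ}
    (hb : ContDiffOn ℝ 1 b (ball 0 3))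
    (hsymm : ∀ y ∈ ball (0 : Fin n → ℝ) 3, ∀ i j, b y i j = b y j i)
    {c : Fin n → Fin n → (Fin n → ℝ) × (Fin n → ℝ) → ℝ} {κ : ℝ}
    (hc : ∀ h l, ContDiffOn ℝ ((⊤ : ℕ∞) : WithTop ℕ∞) (c h l) (ball 0 3 ×ˢ univ))
    (hcκ : ∀ h l, ∀ y ∈ ball (0 : Fin n → ℝ) 3, ∀ v, ‖v‖ ≤ 5 → |c h l (y, v)| ≤ κ)
    (hκ : 4 * (n : ℝ) ^ 4 * κ ≤ 1)
    (heq : ∀ y ∈ ball (0 : Fin n → ℝ) 3, ∀ v,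
      quadForm (fderiv ℝ b y v) v = ∑ h, ∑ l, c h l (y, v) * b y h l) :
    ContDiffOn ℝ ((⊤ : ℕ∞) : WithTop ℕ∞) b (ball 0 3) := by
  have hvert : ∀ m : Fin n × Fin n × Fin 2 × Fin 2, vertex m ∈ closedBall (0 : Fin n → ℝ) 2 :=
    fun m => mem_closedBall_zero_iff.2 (norm_vertex_le m)
  rw [contDiffOn_infty]
  intro k
  refine contDiffOn_of_eq_add_lineOp (K := killingKernel c)
    (s := fun x => ∑ m, (vertexWeight m * quadForm (b (vertex m)) (x - vertex m)) • vertexMatrix m)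
    (κ := n ^ 2 * κ / 2) hvert (by norm_num) (contDiffOn_killingKernel hc)
    (fun m t ht x hx => norm_killingKernel_le hcκ m ht hx) ?_ hb.continuousOn ?_ k
    (ContDiff.contDiffOn ?_)
  · simp
    nlinarith
  · intro x hx
    rw [← sum_vertexWeight_quadForm (hsymm x hx) x, lineOp, ← Finset.sum_add_distrib]
    refine Finset.sum_congr rfl fun m _ => ?_
    rw [quadForm_eq_add_integral isOpen_ball (convex_ball 0 3) hb
      (fun h l => (hc h l).continuousOn) heq (closedBall_subset_ball (by norm_num) (hvert m)) hx]
    simp only [killingKernel_apply, intervalIntegral.integral_smul_const,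
      intervalIntegral.integral_const_mul]
    rw [mul_add, add_smul]
  · unfold quadForm
    fun_prop

/-- A symmetric `C¹` solution `b` of a Killing type equation `(∂_v b)(v, v) = c(y, v) · b` with
smooth coefficients `c` is smooth. -/
theorem contDiffOn_of_killing {b : (Fin n → ℝ) → Fin n → Fin n → ℝ} {U : Set (Fin n → ℝ)}
    (hU : IsOpen U) (hb : ContDiffOn ℝ 1 b U) (hsymm : ∀ y ∈ U, ∀ i j, b y i j = b y j i)
    {c : Fin n → Fin n → (Fin n → ℝ) × (Fin n → ℝ) → ℝ}
    (hc : ∀ h l, ContDiffOn ℝ ((⊤ : ℕ∞) : WithTop ℕ∞) (c h l) (U ×ˢ univ))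
    (heq : ∀ y ∈ U, ∀ v, quadForm (fderiv ℝ b y v) v = ∑ h, ∑ l, c h l (y, v) * b y h l) :
    ContDiffOn ℝ ((⊤ : ℕ∞) : WithTop ℕ∞) b U := by
  intro x₀ hx₀
  obtain ⟨δ, hδ, hδU⟩ := nhds_basis_closedBall.mem_iff.1 (hU.mem_nhds hx₀)
  choose C hC using fun h l => ((isCompact_closedBall x₀ δ).prod
    (isCompact_closedBall (0 : Fin n → ℝ) 5)).exists_bound_of_continuousOn
      ((hc h l).continuousOn.mono (prod_mono hδU (subset_univ _)))
  set C₀ := ∑ h, ∑ l, |C h l|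
  have hCC₀ : ∀ h l, C h l ≤ C₀ := fun h l => (le_abs_self _).trans <|
    (Finset.single_le_sum (f := fun l => |C h l|) (fun _ _ => abs_nonneg _)
      (Finset.mem_univ l)).trans (Finset.single_le_sum (f := fun h => ∑ l, |C h l|)
        (fun _ _ => Finset.sum_nonneg fun _ _ => abs_nonneg _) (Finset.mem_univ h))
  have hC₀ : 0 ≤ C₀ := Finset.sum_nonneg fun _ _ => Finset.sum_nonneg fun _ _ => abs_nonneg _
  obtain ⟨ε, hε, hεδ, hεC⟩ : ∃ ε > 0, 3 * ε ≤ δ ∧ 4 * (n : ℝ) ^ 4 * (ε * C₀) ≤ 1 := by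
    set a := 4 * (n : ℝ) ^ 4 * C₀ with ha_def
    have ha : 0 ≤ a := by positivity
    refine ⟨min (δ / 3) (1 / (a + 1)), by positivity, ?_, ?_⟩
    · linarith [min_le_left (δ / 3) (1 / (a + 1))]
    · have h : min (δ / 3) (1 / (a + 1)) * a ≤ 1 / (a + 1) * a :=
        mul_le_mul_of_nonneg_right (min_le_right _ _) ha
      have h' : 1 / (a + 1) * a ≤ 1 := by
        rw [one_div_mul_eq_div, div_le_one (by positivity)]
        linarith
      calc _ = min (δ / 3) (1 / (a + 1)) * a := by rw [ha_def]; ring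
        _ ≤ 1 := h.trans h'
  have hmem : ∀ y ∈ ball (0 : Fin n → ℝ) 3, x₀ + ε • y ∈ closedBall x₀ δ := by
    intro y hy
    rw [mem_closedBall_iff_norm, add_sub_cancel_left, norm_smul, Real.norm_of_nonneg hε.le]
    nlinarith [mem_ball_zero_iff.1 hy]
  have hφ : ∀ y, HasFDerivAt (fun y : Fin n → ℝ => x₀ + ε • y)
      (ε • ContinuousLinearMap.id ℝ (Fin n → ℝ)) y := fun y =>
    ((hasFDerivAt_id y).const_smul ε).const_add x₀
  have hscaled : ContDiffOn ℝ ((⊤ : ℕ∞) : WithTop ℕ∞) (fun y => b (x₀ + ε • y)) (ball 0 3) := by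
    refine contDiffOn_of_killing_of_small (c := fun h l z => ε * c h l (x₀ + ε • z.1, z.2))
      (κ := ε * C₀) (hb.comp (f := fun y => x₀ + ε • y) (ContDiff.contDiffOn (by fun_prop))
        fun y hy => hδU (hmem y hy)) (fun y hy => hsymm _ (hδU (hmem y hy))) (fun h l => ?_)
      (fun h l y hy v hv => ?_) hεC (fun y hy v => ?_)
    · exact contDiffOn_const.mul ((hc h l).comp (f := fun z : (Fin n → ℝ) × (Fin n → ℝ) =>
        (x₀ + ε • z.1, z.2)) (ContDiff.contDiffOn (by fun_prop))
        fun z hz => ⟨hδU (hmem _ hz.1), mem_univ _⟩)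
    · rw [abs_mul, abs_of_pos hε]
      exact mul_le_mul_of_nonneg_left ((hC h l _ ⟨hmem y hy, mem_closedBall_zero_iff.2 hv⟩).trans
        (hCC₀ h l)) hε.le
    · have hyU := hδU (hmem y hy)
      have hd := (((hb.differentiableOn one_ne_zero).differentiableAt
        (hU.mem_nhds hyU)).hasFDerivAt).comp y (hφ y)
      have hd' : fderiv ℝ (fun y => b (x₀ + ε • y)) y v = ε • fderiv ℝ b (x₀ + ε • y) v := by
        rw [show (fun y => b (x₀ + ε • y)) = b ∘ fun y => x₀ + ε • y from rfl, hd.fderiv]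
        simp
      have hq : quadForm (ε • fderiv ℝ b (x₀ + ε • y) v) v
          = ε * quadForm (fderiv ℝ b (x₀ + ε • y) v) v := by
        simp only [quadForm, Pi.smul_apply, smul_eq_mul, Finset.mul_sum, mul_assoc]
      rw [hd', hq, heq _ hyU]
      simp only [Finset.mul_sum, mul_assoc]
  have h0 : ContDiffAt ℝ ((⊤ : ℕ∞) : WithTop ℕ∞) (fun y => b (x₀ + ε • y)) (ε⁻¹ • (x₀ - x₀)) := by
    simpa using hscaled.contDiffAt (ball_mem_nhds 0 (by norm_num))
  have h1 := ContDiffAt.comp x₀ h0 (f := fun x => ε⁻¹ • (x - x₀))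
    (ContDiff.contDiffAt (by fun_prop))
  refine (h1.congr_of_eventuallyEq (Filter.Eventually.of_forall fun x => ?_)).contDiffWithinAt
  simp [smul_smul, mul_inv_cancel₀ hε.ne']

end Killing

section Determinant

variable {E : Type*} [NormedAddCommGroup E] [NormedSpace ℝ E] {n : ℕ}

theorem contDiffOn_det {k : WithTop ℕ∞} {U : Set E} {M : E → Matrix (Fin n) (Fin n) ℝ}
    (hM : ∀ i j, ContDiffOn ℝ k (fun x => M x i j) U) : ContDiffOn ℝ k (fun x => (M x).det) U := by
  simp only [Matrix.det_apply']
  exact ContDiffOn.sum fun σ _ => contDiffOn_const.mul (contDiffOn_prod fun i _ => hM (σ i) i)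

theorem contDiffOn_matrix_inv_apply {k : WithTop ℕ∞} {U : Set E}
    {M : E → Matrix (Fin n) (Fin n) ℝ} (hM : ∀ i j, ContDiffOn ℝ k (fun x => M x i j) U)
    (hdet : ∀ x ∈ U, IsUnit (M x).det) (i j : Fin n) :
    ContDiffOn ℝ k (fun x => (M x)⁻¹ i j) U := by
  simp only [Matrix.inv_def, Matrix.smul_apply, Ring.inverse_eq_inv', smul_eq_mul,
    Matrix.adjugate_apply]
  refine ((contDiffOn_det hM).inv fun x hx => (hdet x hx).ne_zero).mul (contDiffOn_det fun a b => ?_)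
  by_cases ha : a = j
  · subst ha
    simpa using contDiffOn_const
  · simpa [Matrix.updateRow_ne ha] using hM a b

/-- Jacobi's formula for the derivative of a determinant. -/
theorem hasFDerivAt_det {M : E → Matrix (Fin n) (Fin n) ℝ}
    {M' : Fin n → Fin n → E →L[ℝ] ℝ} {x : E}
    (hM : ∀ i j, HasFDerivAt (fun x => M x i j) (M' i j) x) :
    HasFDerivAt (fun x => (M x).det) (∑ i, ∑ j, (M x).adjugate j i • M' i j) x := by
  simp only [Matrix.det_apply']
  have h := HasFDerivAt.fun_sum (u := Finset.univ) fun (σ : Equiv.Perm (Fin n)) _ =>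
    (HasFDerivAt.finsetProd (u := Finset.univ) fun i _ => hM (σ i) i).const_mul
      ((Equiv.Perm.sign σ : ℤ) : ℝ)
  refine h.congr_fderiv ?_
  ext v
  have hcol : ∀ j, ∑ i, (M x).adjugate j i * M' i j v
      = ((M x).updateCol j fun i => M' i j v).det := by
    intro j
    rw [← Matrix.cramer_apply, Matrix.cramer_eq_adjugate_mulVec]
    rfl
  simp only [sum_apply, smul_apply, smul_eq_mul]
  rw [Finset.sum_comm (f := fun i j => (M x).adjugate j i * M' i j v)]
  simp only [hcol, Matrix.det_apply', Finset.mul_sum]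
  rw [Finset.sum_comm]
  refine Finset.sum_congr rfl fun j _ => Finset.sum_congr rfl fun σ _ => ?_
  rw [← Finset.prod_erase_mul _ _ (Finset.mem_univ j)]
  simp only [Matrix.updateCol_self]
  congr 2
  refine Finset.prod_congr rfl fun i hi => ?_
  rw [Matrix.updateCol_ne (Finset.ne_of_mem_erase hi)]

end Determinant

section Christoffel

variable {n : ℕ} {U : Set (Fin n → ℝ)} {g gbar : Fin n → Fin n → (Fin n → ℝ) → ℝ}
  {ψ : Fin n → (Fin n → ℝ) → ℝ} {r : WithTop ℕ∞} {x : Fin n → ℝ}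

theorem fderiv_apply_eq_sum_pd (f : (Fin n → ℝ) → ℝ) (x v : Fin n → ℝ) :
    fderiv ℝ f x v = ∑ k, v k * pd k f x := by
  conv_lhs => rw [pi_eq_sum_univ' v, map_sum]
  refine Finset.sum_congr rfl fun k _ => ?_
  rw [map_smul, smul_eq_mul, pd]

theorem IsMetric.pd_symm (hU : IsOpen U) (hg : IsMetric r g U) (hx : x ∈ U) (k i j : Fin n) :
    pd k (g i j) x = pd k (g j i) x := by
  unfold pd
  rw [Filter.EventuallyEq.fderiv_eq (f₁ := g i j) (f := g j i)]
  filter_upwards [hU.mem_nhds hx] with y hy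
  exact hg.symm i j y hy

theorem IsMetric.sum_mul_ginv (hg : IsMetric r g U) (hx : x ∈ U) (l k : Fin n) :
    ∑ h, g l h x * ginv g h k x = if l = k then 1 else 0 := by
  have h := congrFun (congrFun (Matrix.mul_nonsing_inv (matAt g x) (hg.inv x hx)) l) k
  rwa [Matrix.mul_apply, Matrix.one_apply] at h

theorem IsMetric.sum_mul_christoffel (hg : IsMetric r g U) (hx : x ∈ U) (l i j : Fin n) :
    ∑ h, g l h x * Christoffel g h i j x
      = (pd i (g j l) x + pd j (g i l) x - pd l (g i j) x) / 2 := by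
  have h : ∑ h, g l h x * Christoffel g h i j x = 1 / 2 * ∑ k, (∑ h, g l h x * ginv g h k x) *
      (pd i (g j k) x + pd j (g i k) x - pd k (g i j) x) := by
    simp only [Christoffel, Finset.mul_sum, Finset.sum_mul]
    rw [Finset.sum_comm]
    exact Finset.sum_congr rfl fun k _ => Finset.sum_congr rfl fun h _ => by ring
  rw [h]
  simp only [hg.sum_mul_ginv hx, ite_mul, one_mul, zero_mul, Finset.sum_ite_eq, Finset.mem_univ,
    if_true]
  ring

/-- The metric is parallel for its Levi-Civita connection. -/
theorem IsMetric.pd_eq (hU : IsOpen U) (hg : IsMetric r g U) (hx : x ∈ U) (k i j : Fin n) :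
    pd k (g i j) x = ∑ h, g j h x * Christoffel g h k i x + ∑ h, g i h x * Christoffel g h k j x := by
  rw [hg.sum_mul_christoffel hx, hg.sum_mul_christoffel hx, hg.pd_symm hU hx k j i,
    hg.pd_symm hU hx i k j, hg.pd_symm hU hx j k i]
  rw [hg.pd_symm hU hx i j k, hg.pd_symm hU hx j i k]
  ring

theorem IsMetric.contDiffOn_christoffel (hU : IsOpen U)
    (hg : IsMetric ((⊤ : ℕ∞) : WithTop ℕ∞) g U) (h i j : Fin n) :
    ContDiffOn ℝ ((⊤ : ℕ∞) : WithTop ℕ∞) (Christoffel g h i j) U := by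
  have hpd : ∀ k a b, ContDiffOn ℝ ((⊤ : ℕ∞) : WithTop ℕ∞) (pd k (g a b)) U := fun k a b =>
    ((hg.contDiff a b).fderiv_of_isOpen hU (by simp)).clm_apply contDiffOn_const
  refine contDiffOn_const.mul (ContDiffOn.sum fun k _ => ContDiffOn.mul ?_
    (((hpd i j k).add (hpd j i k)).sub (hpd k i j)))
  exact contDiffOn_matrix_inv_apply hg.contDiff hg.inv h k

/-- The coefficients of the Killing type equation satisfied by a suitable multiple of a metric that
is geodesically related to `g`. -/
def geodesicCoeff (g : Fin n → Fin n → (Fin n → ℝ) → ℝ) (h l : Fin n)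
    (z : (Fin n → ℝ) × (Fin n → ℝ)) : ℝ :=
  2 * (∑ a, ∑ b, Christoffel g h a b z.1 * (z.2 a * z.2 b)) * z.2 l
    - 4 / (n + 1) * (∑ a, z.2 a * ∑ d, Christoffel g d a d z.1) * (z.2 h * z.2 l)

theorem IsMetric.contDiffOn_geodesicCoeff (hU : IsOpen U)
    (hg : IsMetric ((⊤ : ℕ∞) : WithTop ℕ∞) g U) (h l : Fin n) :
    ContDiffOn ℝ ((⊤ : ℕ∞) : WithTop ℕ∞) (geodesicCoeff g h l) (U ×ˢ univ) := by
  have hΓ : ∀ h a b, ContDiffOn ℝ ((⊤ : ℕ∞) : WithTop ℕ∞)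
      (fun z : (Fin n → ℝ) × (Fin n → ℝ) => Christoffel g h a b z.1) (U ×ˢ univ) := fun h a b =>
    (hg.contDiffOn_christoffel hU h a b).comp contDiffOn_fst fun z hz => hz.1
  have hv : ∀ a, ContDiffOn ℝ ((⊤ : ℕ∞) : WithTop ℕ∞)
      (fun z : (Fin n → ℝ) × (Fin n → ℝ) => z.2 a) (U ×ˢ univ) := fun a =>
    ContDiff.contDiffOn (by fun_prop)
  refine ContDiffOn.sub ((contDiffOn_const.mul ?_).mul (hv l))
    ((contDiffOn_const.mul ?_).mul ((hv h).mul (hv l)))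
  · exact ContDiffOn.sum fun a _ => ContDiffOn.sum fun b _ => (hΓ h a b).mul ((hv a).mul (hv b))
  · exact ContDiffOn.sum fun a _ => (hv a).mul (ContDiffOn.sum fun d _ => hΓ d a d)

theorem GeodesicallyRelated.pd_eq (hU : IsOpen U) (hgbar : IsMetric r gbar U)
    (hgeo : GeodesicallyRelated g gbar ψ U) (hx : x ∈ U) (k i j : Fin n) :
    pd k (gbar i j) x = ∑ h, gbar j h x * Christoffel g h k i x
      + ∑ h, gbar i h x * Christoffel g h k j x
      + (2 * ψ k x * gbar i j x + ψ i x * gbar j k x + ψ j x * gbar i k x) := by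
  rw [hgbar.pd_eq hU hx]
  simp only [hgeo _ _ _ x hx, mul_add, Finset.sum_add_distrib, mul_ite, mul_one, mul_zero,
    Finset.sum_ite_eq', Finset.mem_univ, if_true]
  rw [hgbar.symm j i x hx]
  ring

theorem GeodesicallyRelated.quadForm_fderiv (hU : IsOpen U) (hgbar : IsMetric r gbar U)
    (hgeo : GeodesicallyRelated g gbar ψ U) (hx : x ∈ U) (v : Fin n → ℝ) :
    quadForm (fun i j => fderiv ℝ (gbar i j) x v) v
      = ∑ h, ∑ l, 2 * (∑ a, ∑ b, Christoffel g h a b x * (v a * v b)) * v l * gbar h l x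
        + 4 * (∑ k, v k * ψ k x) * quadForm (fun i j => gbar i j x) v := by
  have hΓ : ∑ i, ∑ j, (∑ k, v k * ∑ h, gbar j h x * Christoffel g h k i x) * (v i * v j)
      = ∑ h, ∑ l, (∑ a, ∑ b, Christoffel g h a b x * (v a * v b)) * v l * gbar h l x := by
    simp only [Finset.mul_sum, Finset.sum_mul]
    rw [Finset.sum_comm, Finset.sum_comm (s := Finset.univ) (t := Finset.univ)
      (f := fun h l => ∑ a, ∑ b, Christoffel g h a b x * (v a * v b) * v l * gbar h l x)]
    refine Finset.sum_congr rfl fun l _ => ?_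
    rw [Finset.sum_comm, Finset.sum_comm (s := Finset.univ) (t := Finset.univ)
      (f := fun h a => ∑ b, Christoffel g h a b x * (v a * v b) * v l * gbar h l x)]
    refine Finset.sum_congr rfl fun a _ => ?_
    rw [Finset.sum_comm]
    refine Finset.sum_congr rfl fun h _ => Finset.sum_congr rfl fun b _ => ?_
    rw [hgbar.symm l h x hx]
    ring
  have hΓ' : ∑ i, ∑ j, (∑ k, v k * ∑ h, gbar i h x * Christoffel g h k j x) * (v i * v j)
      = ∑ h, ∑ l, (∑ a, ∑ b, Christoffel g h a b x * (v a * v b)) * v l * gbar h l x := by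
    rw [← hΓ, Finset.sum_comm]
    exact Finset.sum_congr rfl fun i _ => Finset.sum_congr rfl fun j _ => by ring
  have hψ : ∑ i, ∑ j, (∑ k, v k * (2 * ψ k x * gbar i j x + ψ i x * gbar j k x
      + ψ j x * gbar i k x)) * (v i * v j)
      = 4 * (∑ k, v k * ψ k x) * quadForm (fun i j => gbar i j x) v := by
    have hfst : ∑ i, ∑ j, (∑ k, v k * (ψ i x * gbar j k x)) * (v i * v j)
        = (∑ k, v k * ψ k x) * quadForm (fun i j => gbar i j x) v := by
      simp only [quadForm, Finset.sum_mul]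
      simp only [Finset.mul_sum]
      exact Finset.sum_congr rfl fun i _ => Finset.sum_congr rfl fun j _ =>
        Finset.sum_congr rfl fun k _ => by ring
    have hsnd : ∑ i, ∑ j, (∑ k, v k * (ψ j x * gbar i k x)) * (v i * v j)
        = (∑ k, v k * ψ k x) * quadForm (fun i j => gbar i j x) v := by
      rw [← hfst, Finset.sum_comm]
      exact Finset.sum_congr rfl fun i _ => Finset.sum_congr rfl fun j _ => by ring
    have htrd : ∑ i, ∑ j, (∑ k, v k * (2 * ψ k x * gbar i j x)) * (v i * v j)
        = 2 * (∑ k, v k * ψ k x) * quadForm (fun i j => gbar i j x) v := by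
      simp only [quadForm, Finset.mul_sum, Finset.sum_mul]
      exact Finset.sum_congr rfl fun i _ => Finset.sum_congr rfl fun j _ =>
        Finset.sum_congr rfl fun k _ => by ring
    simp only [mul_add (v _), Finset.sum_add_distrib, add_mul]
    rw [hfst, hsnd, htrd]
    ring
  have htwo : ∑ h, ∑ l, 2 * (∑ a, ∑ b, Christoffel g h a b x * (v a * v b)) * v l * gbar h l x
      = 2 * ∑ h, ∑ l, (∑ a, ∑ b, Christoffel g h a b x * (v a * v b)) * v l * gbar h l x := by
    simp only [mul_assoc, ← Finset.mul_sum (a := (2 : ℝ))]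
  rw [htwo, ← hψ]
  have hsplit : ∀ i j, fderiv ℝ (gbar i j) x v
      = ∑ k, v k * ∑ h, gbar j h x * Christoffel g h k i x
        + ∑ k, v k * ∑ h, gbar i h x * Christoffel g h k j x
        + ∑ k, v k * (2 * ψ k x * gbar i j x + ψ i x * gbar j k x + ψ j x * gbar i k x) := by
    intro i j
    rw [fderiv_apply_eq_sum_pd, ← Finset.sum_add_distrib, ← Finset.sum_add_distrib]
    exact Finset.sum_congr rfl fun k _ => by rw [hgeo.pd_eq hU hgbar hx]; ring
  simp only [quadForm, hsplit]
  simp_rw [add_mul, Finset.sum_add_distrib]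
  rw [hΓ, hΓ', two_mul]

/-- The derivative of the determinant of a metric that is geodesically related to `g`. -/
theorem GeodesicallyRelated.hasFDerivAt_det (hU : IsOpen U) (hgbar : IsMetric 1 gbar U)
    (hgeo : GeodesicallyRelated g gbar ψ U) (hx : x ∈ U) :
    ∃ D : (Fin n → ℝ) →L[ℝ] ℝ, HasFDerivAt (fun y => (matAt gbar y).det) D x ∧
      ∀ v, D v = 2 * (matAt gbar x).det *
        (∑ a, v a * ∑ d, Christoffel g d a d x + (n + 1) * ∑ a, v a * ψ a x) := by
  have hd : ∀ i j, HasFDerivAt (fun y => matAt gbar y i j) (fderiv ℝ (gbar i j) x) x := fun i j =>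
    (((hgbar.contDiff i j).contDiffAt (hU.mem_nhds hx)).differentiableAt one_ne_zero).hasFDerivAt
  refine ⟨_, _root_.hasFDerivAt_det hd, fun v => ?_⟩
  set δ := (matAt gbar x).det
  have hadj : ∀ h j, ∑ i, (matAt gbar x).adjugate j i * gbar i h x = if j = h then δ else 0 := by
    intro h j
    have heq := congrFun (congrFun (Matrix.adjugate_mul (matAt gbar x)) j) h
    simpa [Matrix.mul_apply, Matrix.one_apply, matAt, δ] using heq
  have hadj' : ∀ h i, ∑ j, (matAt gbar x).adjugate j i * gbar j h x = if i = h then δ else 0 := by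
    intro h i
    have heq := congrFun (congrFun (Matrix.mul_adjugate (matAt gbar x)) h) i
    simp only [Matrix.mul_apply, Matrix.smul_apply, Matrix.one_apply, smul_eq_mul, mul_ite, mul_one,
      mul_zero, eq_comm (a := h)] at heq
    rw [← heq]
    exact Finset.sum_congr rfl fun j _ => by rw [hgbar.symm j h x hx, mul_comm]; rfl
  have htrace : ∀ k, ∑ i, ∑ j, (matAt gbar x).adjugate j i * pd k (gbar i j) x
      = 2 * δ * (∑ d, Christoffel g d k d x + (n + 1) * ψ k x) := by
    intro k
    have hΓ : ∑ i, ∑ j, (matAt gbar x).adjugate j i * ∑ h, gbar j h x * Christoffel gbar h k i x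
        = δ * ∑ d, Christoffel gbar d k d x := by
      rw [Finset.mul_sum]
      refine Finset.sum_congr rfl fun i _ => ?_
      simp only [Finset.mul_sum, ← mul_assoc]
      rw [Finset.sum_comm]
      simp only [← Finset.sum_mul, hadj', ite_mul, zero_mul, Finset.sum_ite_eq, Finset.mem_univ,
        if_true]
    have hΓ' : ∑ i, ∑ j, (matAt gbar x).adjugate j i * ∑ h, gbar i h x * Christoffel gbar h k j x
        = δ * ∑ d, Christoffel gbar d k d x := by
      rw [Finset.mul_sum, Finset.sum_comm]
      refine Finset.sum_congr rfl fun j _ => ?_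
      simp only [Finset.mul_sum, ← mul_assoc]
      rw [Finset.sum_comm]
      simp only [← Finset.sum_mul, hadj, ite_mul, zero_mul, Finset.sum_ite_eq, Finset.mem_univ,
        if_true]
    have hgeo' : ∑ d, Christoffel gbar d k d x = ∑ d, Christoffel g d k d x + (n + 1) * ψ k x := by
      simp only [hgeo _ _ _ x hx, Finset.sum_add_distrib, mul_ite, mul_one, mul_zero,
        Finset.sum_ite_eq', Finset.mem_univ, if_true, Finset.sum_const, Finset.card_univ,
        Fintype.card_fin, nsmul_eq_mul]
      ring
    simp only [hgbar.pd_eq hU hx, mul_add, Finset.sum_add_distrib]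
    rw [hΓ, hΓ', hgeo']
    ring
  simp only [sum_apply, smul_apply, smul_eq_mul, fderiv_apply_eq_sum_pd]
  calc ∑ i, ∑ j, (matAt gbar x).adjugate j i * ∑ k, v k * pd k (gbar i j) x
      = ∑ k, v k * ∑ i, ∑ j, (matAt gbar x).adjugate j i * pd k (gbar i j) x := by
        simp only [Finset.mul_sum]
        rw [Finset.sum_comm (s := Finset.univ) (t := Finset.univ) (f := fun k i => ∑ j,
          v k * ((matAt gbar x).adjugate j i * pd k (gbar i j) x))]
        refine Finset.sum_congr rfl fun i _ => ?_
        rw [Finset.sum_comm]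
        exact Finset.sum_congr rfl fun k _ => Finset.sum_congr rfl fun j _ => by ring
    _ = _ := by
        simp only [htrace, mul_add, Finset.sum_add_distrib, Finset.mul_sum]
        congr 1
        · exact Finset.sum_congr rfl fun k _ => Finset.sum_congr rfl fun d _ => by ring
        · exact Finset.sum_congr rfl fun k _ => by ring

end Christoffel

section Rescaling

variable {n : ℕ} {U : Set (Fin n → ℝ)} {g gbar : Fin n → Fin n → (Fin n → ℝ) → ℝ}
  {ψ : Fin n → (Fin n → ℝ) → ℝ} {x : Fin n → ℝ}

/-- The weight `|det g| ^ (-2 / (n + 1))`. -/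
def detWeight (g : Fin n → Fin n → (Fin n → ℝ) → ℝ) (x : Fin n → ℝ) : ℝ :=
  ((matAt g x).det ^ 2) ^ (-(1 / ((n : ℝ) + 1)))

/-- A metric multiplied by its weight `|det g| ^ (-2 / (n + 1))`. -/
def weightedMetric (g : Fin n → Fin n → (Fin n → ℝ) → ℝ) (x : Fin n → ℝ) (i j : Fin n) : ℝ :=
  detWeight g x * g i j x

theorem IsMetric.det_sq_pos {r : WithTop ℕ∞} (hg : IsMetric r g U) (hx : x ∈ U) :
    0 < (matAt g x).det ^ 2 :=
  sq_pos_of_ne_zero (hg.inv x hx).ne_zero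

theorem IsMetric.contDiffOn_weightedMetric {r : WithTop ℕ∞} (hg : IsMetric r g U) :
    ContDiffOn ℝ r (weightedMetric g) U := by
  refine contDiffOn_pi.2 fun i => contDiffOn_pi.2 fun j => ContDiffOn.mul ?_ (hg.contDiff i j)
  exact ((contDiffOn_det hg.contDiff).pow 2).rpow_const_of_ne fun x hx => (hg.det_sq_pos hx).ne'

theorem GeodesicallyRelated.hasFDerivAt_detWeight (hU : IsOpen U) (hgbar : IsMetric 1 gbar U)
    (hgeo : GeodesicallyRelated g gbar ψ U) (hx : x ∈ U) :
    ∃ D : (Fin n → ℝ) →L[ℝ] ℝ, HasFDerivAt (detWeight gbar) D x ∧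
      ∀ v, D v = -detWeight gbar x * (4 / (n + 1) * (∑ a, v a * ∑ d, Christoffel g d a d x)
        + 4 * ∑ a, v a * ψ a x) := by
  obtain ⟨D, hD, hDv⟩ := hgeo.hasFDerivAt_det hU hgbar hx
  have hne := (hgbar.inv x hx).ne_zero
  have hpos := hgbar.det_sq_pos hx
  refine ⟨_, (hD.pow 2).rpow_const (Or.inl hpos.ne'), fun v => ?_⟩
  have hn : (n : ℝ) + 1 ≠ 0 := by positivity
  simp only [smul_apply, smul_eq_mul, hDv, Real.rpow_sub_one hpos.ne', detWeight]
  field_simp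
  ring

theorem GeodesicallyRelated.quadForm_fderiv_weightedMetric (hU : IsOpen U)
    (hgbar : IsMetric 1 gbar U) (hgeo : GeodesicallyRelated g gbar ψ U) (hx : x ∈ U)
    (v : Fin n → ℝ) :
    quadForm (fderiv ℝ (weightedMetric gbar) x v) v
      = ∑ h, ∑ l, geodesicCoeff g h l (x, v) * weightedMetric gbar x h l := by
  obtain ⟨D, hD, hDv⟩ := hgeo.hasFDerivAt_detWeight hU hgbar hx
  have hd : ∀ i j, HasFDerivAt (gbar i j) (fderiv ℝ (gbar i j) x) x := fun i j =>
    (((hgbar.contDiff i j).contDiffAt (hU.mem_nhds hx)).differentiableAt one_ne_zero).hasFDerivAt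
  have hb : HasFDerivAt (weightedMetric gbar) (ContinuousLinearMap.pi fun i =>
      ContinuousLinearMap.pi fun j => detWeight gbar x • fderiv ℝ (gbar i j) x + gbar i j x • D) x :=
    hasFDerivAt_pi.2 fun i => hasFDerivAt_pi.2 fun j => hD.mul (hd i j)
  have hsplit : quadForm (fderiv ℝ (weightedMetric gbar) x v) v
      = detWeight gbar x * quadForm (fun i j => fderiv ℝ (gbar i j) x v) v
        + D v * quadForm (fun i j => gbar i j x) v := by
    simp only [hb.fderiv, quadForm, Finset.mul_sum, ← Finset.sum_add_distrib]
    refine Finset.sum_congr rfl fun i _ => Finset.sum_congr rfl fun j _ => ?_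
    simp only [ContinuousLinearMap.coe_pi', add_apply, smul_apply, smul_eq_mul]
    ring
  have hcoeff : ∑ h, ∑ l, geodesicCoeff g h l (x, v) * weightedMetric gbar x h l
      = detWeight gbar x * ∑ h, ∑ l,
          2 * (∑ a, ∑ b, Christoffel g h a b x * (v a * v b)) * v l * gbar h l x
        - detWeight gbar x * (4 / (n + 1) * (∑ a, v a * ∑ d, Christoffel g d a d x))
          * quadForm (fun i j => gbar i j x) v := by
    rw [quadForm, Finset.mul_sum, Finset.mul_sum, ← Finset.sum_sub_distrib]
    refine Finset.sum_congr rfl fun h _ => ?_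
    rw [Finset.mul_sum (a := detWeight gbar x), Finset.mul_sum (a := detWeight gbar x * _),
      ← Finset.sum_sub_distrib]
    refine Finset.sum_congr rfl fun l _ => ?_
    rw [geodesicCoeff, weightedMetric]
    ring
  rw [hsplit, hcoeff, hDv, hgeo.quadForm_fderiv hU hgbar hx]
  ring

/-- A metric is determined by its weighted version. -/
theorem IsMetric.detWeight_eq {r : WithTop ℕ∞} (hn : 2 ≤ n) (hg : IsMetric r g U) (hx : x ∈ U) :
    detWeight g x = ((Matrix.of (weightedMetric g x)).det ^ 2) ^ (1 / ((n : ℝ) - 1)) := by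
  have hpos := hg.det_sq_pos hx
  have hdet : (Matrix.of (weightedMetric g x)).det = detWeight g x ^ n * (matAt g x).det := by
    have h := Matrix.det_smul (matAt g x) (detWeight g x)
    rwa [Fintype.card_fin] at h
  have hn1 : (n : ℝ) - 1 ≠ 0 := by
    have : (2 : ℝ) ≤ n := by exact_mod_cast hn
    linarith
  have hn2 : (n : ℝ) + 1 ≠ 0 := by positivity
  rw [hdet, mul_pow, ← pow_mul, detWeight, ← Real.rpow_mul_natCast hpos.le]
  nth_rewrite 3 [← Real.rpow_one ((matAt g x).det ^ 2)]
  rw [← Real.rpow_add hpos, ← Real.rpow_mul hpos.le]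
  congr 1
  push_cast
  field_simp
  ring

end Rescaling

/-- Geodesic mappings preserve smoothness: if `g ∈ C^∞` and `ḡ ∈ C^1` are geodesically
related via a continuous 1-form `ψ` on an open set `U ⊆ ℝⁿ` (`n ≥ 2`), then `ḡ ∈ C^∞`. -/
theorem geodesic_mapping_preserves_Cinfty
    {n : ℕ} (hn : 2 ≤ n) (U : Set (Fin n → ℝ)) (hU : IsOpen U)
    (g gbar : Fin n → Fin n → (Fin n → ℝ) → ℝ)
    (hg : IsMetric ((⊤ : ℕ∞) : WithTop ℕ∞) g U) (hgbar : IsMetric 1 gbar U)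
    (ψ : Fin n → (Fin n → ℝ) → ℝ) (hψ : ∀ i, ContinuousOn (ψ i) U)
    (hgeo : GeodesicallyRelated g gbar ψ U) :
    ∀ i j, ContDiffOn ℝ ((⊤ : ℕ∞) : WithTop ℕ∞) (gbar i j) U := by
  have hb : ContDiffOn ℝ ((⊤ : ℕ∞) : WithTop ℕ∞) (weightedMetric gbar) U :=
    contDiffOn_of_killing hU hgbar.contDiffOn_weightedMetric
      (fun y hy i j => by rw [weightedMetric, weightedMetric, hgbar.symm i j y hy])
      (hg.contDiffOn_geodesicCoeff hU)
      fun y hy v => hgeo.quadForm_fderiv_weightedMetric hU hgbar hy v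
  have hbij : ∀ i j, ContDiffOn ℝ ((⊤ : ℕ∞) : WithTop ℕ∞)
      (fun x => weightedMetric gbar x i j) U := fun i j =>
    contDiffOn_pi.1 (contDiffOn_pi.1 hb i) j
  have hne : ∀ x ∈ U, detWeight gbar x ≠ 0 := fun x hx =>
    (Real.rpow_pos_of_pos (hgbar.det_sq_pos hx) _).ne'
  have hweight : ContDiffOn ℝ ((⊤ : ℕ∞) : WithTop ℕ∞) (detWeight gbar) U := by
    have hdet : ContDiffOn ℝ ((⊤ : ℕ∞) : WithTop ℕ∞)
        (fun x => (Matrix.of (weightedMetric gbar x)).det) U := contDiffOn_det hbij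
    refine ((hdet.pow 2).rpow_const_of_ne fun x hx h => hne x hx ?_).congr fun x hx =>
      hgbar.detWeight_eq hn hx
    have : (1 : ℝ) < n := by exact_mod_cast hn
    rw [hgbar.detWeight_eq hn hx, h, Real.zero_rpow (one_div_ne_zero (by linarith))]
  exact fun i j => ((hbij i j).div hweight hne).congr fun x hx =>
    (mul_div_cancel_left₀ _ (hne x hx)).symm
end
end

section
/- Let n ≥ 2. Suppose g is a pseudo-Riemannian metric on an open set U ⊆ ℝ^n all of whose components g_{ij} are real-analytic on U, ḡ is a pseudo-Riemannian metric of class C^1 on U, and g and ḡ are geodesically related via a continuous 1-form ψ. Then all components ḡ_{ij} are real-analytic on U. -/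
noncomputable section
open scoped BigOperators

section LineDerivatives

open Set Filter Topology

variable {E : Type*} [NormedAddCommGroup E] [NormedSpace ℝ E]

/-- `f` has line derivative `f'` in the direction `v` at every point of `U`. -/
def HasLineDerivOn (U : Set E) (v : E) (f f' : E → ℝ) : Prop :=
  ∀ x ∈ U, HasLineDerivAt ℝ f (f' x) x v

theorem HasLineDerivAt.hasDerivAt_comp_line {f : E → ℝ} {f' : ℝ} {x v : E} {s : ℝ}
    (h : HasLineDerivAt ℝ f f' (x + s • v) v) :
    HasDerivAt (fun t : ℝ => f (x + t • v)) f' s := by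
  have h1 : HasDerivAt (fun t : ℝ => f (x + s • v + t • v)) f' (s - s) := by
    rw [sub_self]; exact h
  have h2 := h1.comp_sub_const s s
  refine h2.congr_of_eventuallyEq (Eventually.of_forall fun t => ?_)
  simp only [add_assoc, ← add_smul]
  congr 3; ring

theorem HasLineDerivOn.congr {U : Set E} (hU : IsOpen U) {v : E} {f f' g g' : E → ℝ}
    (h : HasLineDerivOn U v f f') (hf : EqOn f g U) (hf' : EqOn f' g' U) :
    HasLineDerivOn U v g g' := fun x hx => by
  rw [← hf' hx]
  exact (h x hx).congr_of_eventuallyEq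
    ((hf.symm.eventuallyEq_of_mem (hU.mem_nhds hx)))

theorem HasLineDerivOn.add {U : Set E} {v : E} {f f' g g' : E → ℝ}
    (hf : HasLineDerivOn U v f f') (hg : HasLineDerivOn U v g g') :
    HasLineDerivOn U v (fun x => f x + g x) (fun x => f' x + g' x) :=
  fun x hx => HasDerivAt.add (hf x hx) (hg x hx)

theorem HasLineDerivOn.sub {U : Set E} {v : E} {f f' g g' : E → ℝ}
    (hf : HasLineDerivOn U v f f') (hg : HasLineDerivOn U v g g') :
    HasLineDerivOn U v (fun x => f x - g x) (fun x => f' x - g' x) :=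
  fun x hx => HasDerivAt.sub (hf x hx) (hg x hx)

theorem HasLineDerivOn.mul {U : Set E} {v : E} {f f' g g' : E → ℝ}
    (hf : HasLineDerivOn U v f f') (hg : HasLineDerivOn U v g g') :
    HasLineDerivOn U v (fun x => f x * g x) (fun x => f' x * g x + f x * g' x) :=
  fun x hx => by simpa using! HasDerivAt.mul (hf x hx) (hg x hx)

theorem integral_line_eq_sub {U : Set E} {w : E} {f f' : E → ℝ} (hf' : ContinuousOn f' U)
    (hff' : HasLineDerivOn U w f f') {x : E} {t : ℝ} (hseg : ∀ s ∈ uIcc 0 t, x + s • w ∈ U) :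
    ∫ s in (0 : ℝ)..t, f' (x + s • w) = f (x + t • w) - f x := by
  have h := intervalIntegral.integral_eq_sub_of_hasDerivAt
    (fun s hs => (hff' _ (hseg s hs)).hasDerivAt_comp_line)
    (ContinuousOn.intervalIntegrable (hf'.comp (by fun_prop) hseg))
  simpa using h

theorem eventually_segment_mem {U : Set E} (hU : IsOpen U) {x : E} (hx : x ∈ U) (w : E) :
    ∀ᶠ t : ℝ in 𝓝 0, ∀ᶠ y in 𝓝 x, ∀ s ∈ uIcc 0 t, y + s • w ∈ U := by
  have h : ∀ᶠ p : ℝ × E in 𝓝 (0, x), p.2 + p.1 • w ∈ U :=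
    ContinuousAt.preimage_mem_nhds (f := fun p : ℝ × E => p.2 + p.1 • w) (by fun_prop)
      (by simpa using! hU.mem_nhds hx)
  rw [nhds_prod_eq, eventually_prod_iff] at h
  obtain ⟨P, hP, Q, hQ, hPQ⟩ := h
  obtain ⟨ε, hε, hball⟩ := Metric.mem_nhds_iff.1 hP
  filter_upwards [Metric.ball_mem_nhds (0 : ℝ) hε] with t ht
  filter_upwards [hQ] with y hy s hs
  refine hPQ (hball ?_) hy
  have h1 : |s - 0| ≤ |t - 0| := abs_sub_left_of_mem_uIcc hs
  have h2 : |t - 0| < ε := by simpa [Real.dist_eq] using ht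
  simpa [Real.dist_eq] using h1.trans_lt h2

variable [ProperSpace E]

theorem exists_bound_near_segment {U : Set E} (hU : IsOpen U) {G : E → ℝ} (hG : ContinuousOn G U)
    {x w : E} {t : ℝ} (hseg : ∀ s ∈ uIcc 0 t, x + s • w ∈ U) :
    ∃ δ > 0, ∃ C, ∀ s ∈ uIcc 0 t, ∀ y, dist y x ≤ δ →
      y + s • w ∈ U ∧ ‖G (y + s • w)‖ ≤ C := by
  have hK : IsCompact ((fun s : ℝ => x + s • w) '' uIcc 0 t) :=
    isCompact_uIcc.image (by fun_prop)
  obtain ⟨δ, hδ, hsub⟩ := hK.exists_cthickening_subset_open hU (image_subset_iff.2 hseg)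
  obtain ⟨C, hC⟩ := hK.cthickening.exists_bound_of_continuousOn (hG.mono hsub)
  refine ⟨δ, hδ, C, fun s hs y hy => ?_⟩
  have hmem : y + s • w ∈ Metric.cthickening δ ((fun s : ℝ => x + s • w) '' uIcc 0 t) :=
    Metric.mem_cthickening_of_dist_le _ _ _ _ (mem_image_of_mem _ hs) (by simpa using hy)
  exact ⟨hsub hmem, hC _ hmem⟩

theorem continuousAt_integral_line {U : Set E} (hU : IsOpen U) {G : E → ℝ}
    (hG : ContinuousOn G U) {c : ℝ → ℝ} (hc : Continuous c)
    {x w : E} {t : ℝ} (hseg : ∀ s ∈ uIcc 0 t, x + s • w ∈ U) :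
    ContinuousAt (fun y => ∫ s in (0 : ℝ)..t, c s * G (y + s • w)) x := by
  obtain ⟨δ, hδ, C, hC⟩ := exists_bound_near_segment hU hG hseg
  refine intervalIntegral.continuousAt_of_dominated_interval
    (bound := fun s => |c s| * C) ?_ ?_ ?_ ?_
  · filter_upwards [Metric.closedBall_mem_nhds x hδ] with y hy
    refine (ContinuousOn.intervalIntegrable ?_).aestronglyMeasurable_restrict_uIoc
    exact hc.continuousOn.mul (hG.comp (by fun_prop) fun s hs => (hC s hs y hy).1)
  · filter_upwards [Metric.closedBall_mem_nhds x hδ] with y hy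
    refine Eventually.of_forall fun s hs => ?_
    rw [norm_mul, Real.norm_eq_abs]
    exact mul_le_mul_of_nonneg_left (hC s (uIoc_subset_uIcc hs) y hy).2 (abs_nonneg _)
  · exact (Continuous.mul hc.abs continuous_const).intervalIntegrable _ _
  · refine Eventually.of_forall fun s hs => continuousAt_const.mul ?_
    exact ContinuousAt.comp (f := fun y => y + s • w) (g := G)
      (hG.continuousAt (hU.mem_nhds (hseg s (uIoc_subset_uIcc hs)))) (by fun_prop)

theorem hasLineDerivAt_integral_line {U : Set E} (hU : IsOpen U) {v : E} {G G' : E → ℝ}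
    (hG : ContinuousOn G U) (hG' : ContinuousOn G' U) (hGG' : HasLineDerivOn U v G G')
    {c : ℝ → ℝ} (hc : Continuous c) {x w : E} {t : ℝ} (hseg : ∀ s ∈ uIcc 0 t, x + s • w ∈ U) :
    HasLineDerivAt ℝ (fun y => ∫ s in (0 : ℝ)..t, c s * G (y + s • w))
      (∫ s in (0 : ℝ)..t, c s * G' (x + s • w)) x v := by
  obtain ⟨δ, hδ, C, hC⟩ := exists_bound_near_segment hU hG' hseg
  have hmem : (fun τ : ℝ => x + τ • v) ⁻¹' Metric.closedBall x δ ∈ 𝓝 (0 : ℝ) :=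
    ContinuousAt.preimage_mem_nhds (by fun_prop)
      (by simpa using Metric.closedBall_mem_nhds x hδ)
  have h0 : x + (0 : ℝ) • v ∈ Metric.closedBall x δ := by simpa using hδ.le
  have hline : ∀ (H : E → ℝ), ContinuousOn H U → ∀ τ : ℝ, x + τ • v ∈ Metric.closedBall x δ →
      ContinuousOn (fun s : ℝ => c s * H (x + τ • v + s • w)) (uIcc 0 t) := fun H hH τ hτ =>
    hc.continuousOn.mul (hH.comp (by fun_prop) fun s hs => (hC s hs _ hτ).1)
  have h := (intervalIntegral.hasDerivAt_integral_of_dominated_loc_of_deriv_le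
    (F := fun τ s => c s * G (x + τ • v + s • w)) (F' := fun τ s => c s * G' (x + τ • v + s • w))
    (bound := fun s => |c s| * C) (a := 0) (b := t) (μ := MeasureTheory.volume) hmem
    ?_ ?_ ?_ ?_ ?_ ?_).2
  · simpa [HasLineDerivAt] using! h
  · filter_upwards [hmem] with τ hτ
    exact (hline G hG τ hτ).intervalIntegrable.aestronglyMeasurable_restrict_uIoc
  · exact (hline G hG 0 h0).intervalIntegrable
  · exact (hline G' hG' 0 h0).intervalIntegrable.aestronglyMeasurable_restrict_uIoc
  · refine Eventually.of_forall fun s hs τ hτ => ?_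
    rw [norm_mul, Real.norm_eq_abs]
    exact mul_le_mul_of_nonneg_left (hC s (uIoc_subset_uIcc hs) _ hτ).2 (abs_nonneg _)
  · exact (Continuous.mul hc.abs continuous_const).intervalIntegrable _ _
  · refine Eventually.of_forall fun s hs τ hτ => HasDerivAt.const_mul _ ?_
    have hU' : (x + s • w) + τ • v ∈ U := by
      rw [add_right_comm]; exact (hC s (uIoc_subset_uIcc hs) _ hτ).1
    have h1 := (hGG' _ hU').hasDerivAt_comp_line
    simpa only [add_right_comm] using h1

/-- Interchange of mixed line derivatives: `∂_w ∂_v f` exists as soon as `∂_v ∂_w f` exists and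
is continuous. -/
theorem HasLineDerivOn.swap {U : Set E} (hU : IsOpen U) {v w : E} {f fv fw fwv : E → ℝ}
    (hv : HasLineDerivOn U v f fv) (hw : HasLineDerivOn U w f fw)
    (hwv : HasLineDerivOn U v fw fwv) (cw : ContinuousOn fw U) (cwv : ContinuousOn fwv U) :
    HasLineDerivOn U w fv fwv := by
  intro x hx
  have key : ∀ᶠ t : ℝ in 𝓝 0,
      fv (x + t • w) = fv x + ∫ s in (0 : ℝ)..t, fwv (x + s • w) := by
    filter_upwards [eventually_segment_mem hU hx w] with t ht
    have hseg := ht.self_of_nhds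
    have h1 := hasLineDerivAt_integral_line hU cw cwv hwv (continuous_const (y := (1 : ℝ))) hseg
    simp only [one_mul] at h1
    have h2 : HasLineDerivAt ℝ (fun y => f (y + t • w) - f y) (fv (x + t • w) - fv x) x v := by
      refine HasDerivAt.sub ?_ (hv x hx)
      have h3 := hv _ (hseg t right_mem_uIcc)
      simpa only [HasLineDerivAt, add_right_comm] using h3
    have h4 := h1.congr_of_eventuallyEq (f₁ := fun y => f (y + t • w) - f y)
      (ht.mono fun y hy => (integral_line_eq_sub cw hw hy).symm)
    linarith [h2.unique h4]
  have hcont : ContinuousAt (fun s : ℝ => fwv (x + s • w)) 0 :=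
    ContinuousAt.comp (f := fun s : ℝ => x + s • w) (g := fwv)
      (cwv.continuousAt (by simpa using hU.mem_nhds hx)) (by fun_prop)
  have hd : HasDerivAt (fun t : ℝ => ∫ s in (0 : ℝ)..t, fwv (x + s • w)) (fwv (x + (0 : ℝ) • w)) 0 := by
    refine intervalIntegral.integral_hasDerivAt_right (by simp) ?_ hcont
    have hopen : IsOpen ((fun s : ℝ => x + s • w) ⁻¹' U) := hU.preimage (by fun_prop)
    have hco : ContinuousOn (fun s : ℝ => fwv (x + s • w)) ((fun s : ℝ => x + s • w) ⁻¹' U) :=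
      cwv.comp (by fun_prop) fun s hs => hs
    exact hco.stronglyMeasurableAtFilter hopen 0 (by simpa using hx)
  have := (hd.const_add (fv x)).congr_of_eventuallyEq key
  simpa [HasLineDerivAt] using! this

/-- If `∂_w h = p + F` with `h`, `F` and `∂_w p` continuously differentiable along `v`, then so
is `p`. -/
theorem exists_hasLineDerivOn_of_second_order {U : Set E} (hU : IsOpen U) {v w : E}
    {h hv p F Fv r rv : E → ℝ} (Dwh : HasLineDerivOn U w h (fun x => p x + F x))
    (Dvh : HasLineDerivOn U v h hv) (Dwp : HasLineDerivOn U w p r)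
    (DvF : HasLineDerivOn U v F Fv) (Dvr : HasLineDerivOn U v r rv)
    (chv : ContinuousOn hv U) (cF : ContinuousOn F U) (cFv : ContinuousOn Fv U)
    (cr : ContinuousOn r U) (crv : ContinuousOn rv U) :
    ∃ p', ContinuousOn p' U ∧ HasLineDerivOn U v p p' := by
  suffices H : ∀ x ∈ U, ∃ p' : E → ℝ, ContinuousAt p' x ∧
      ∀ᶠ y in 𝓝 x, HasLineDerivAt ℝ p (p' y) y v by
    refine ⟨fun x => lineDeriv ℝ p x v, fun x hx => ?_, fun x hx => ?_⟩
    · obtain ⟨p', cp', hp'⟩ := H x hx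
      exact (cp'.congr (hp'.mono fun y hy => hy.lineDeriv.symm)).continuousWithinAt
    · obtain ⟨p', -, hp'⟩ := H x hx
      exact hp'.self_of_nhds.lineDifferentiableAt.hasLineDerivAt
  intro x hx
  obtain ⟨t, ht, ht0⟩ : ∃ t : ℝ, (∀ᶠ y in 𝓝 x, ∀ s ∈ uIcc 0 t, y + s • w ∈ U) ∧ t ≠ 0 := by
    have h1 := (eventually_segment_mem hU hx w).filter_mono (nhdsWithin_le_nhds (s := {(0 : ℝ)}ᶜ))
    exact (h1.and self_mem_nhdsWithin).exists
  have hct : Continuous fun s : ℝ => t - s := by fun_prop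
  have hc1 : Continuous fun _ : ℝ => (1 : ℝ) := continuous_const
  have key : ∀ᶠ y in 𝓝 x, p y = t⁻¹ * (h (y + t • w) - h y -
      ((∫ s in (0 : ℝ)..t, 1 * F (y + s • w)) + ∫ s in (0 : ℝ)..t, (t - s) * r (y + s • w))) := by
    filter_upwards [ht] with y hy
    have hcF : ContinuousOn (fun s : ℝ => 1 * F (y + s • w)) (uIcc 0 t) :=
      hc1.continuousOn.mul (cF.comp (by fun_prop) hy)
    have hcr : ContinuousOn (fun s : ℝ => (t - s) * r (y + s • w)) (uIcc 0 t) :=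
      hct.continuousOn.mul (cr.comp (by fun_prop) hy)
    have hderiv : ∀ s ∈ uIcc 0 t,
        HasDerivAt (fun s : ℝ => h (y + s • w) + (t - s) * p (y + s • w))
          (1 * F (y + s • w) + (t - s) * r (y + s • w)) s := by
      intro s hs
      have h1 := (Dwh _ (hy s hs)).hasDerivAt_comp_line
      have h2 := (Dwp _ (hy s hs)).hasDerivAt_comp_line
      have h3 := h1.add ((((hasDerivAt_id s).const_sub t)).mul h2)
      refine h3.congr_deriv ?_
      simp only [id]; ring
    have hint := intervalIntegral.integral_eq_sub_of_hasDerivAt hderiv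
      (hcF.add hcr).intervalIntegrable
    rw [intervalIntegral.integral_add hcF.intervalIntegrable hcr.intervalIntegrable] at hint
    rw [hint]
    simp only [sub_self, zero_smul, add_zero, zero_mul, sub_zero]
    field_simp
    ring
  refine ⟨fun y => t⁻¹ * (hv (y + t • w) - hv y -
      ((∫ s in (0 : ℝ)..t, 1 * Fv (y + s • w)) + ∫ s in (0 : ℝ)..t, (t - s) * rv (y + s • w))),
      ?_, ?_⟩
  · have hseg := ht.self_of_nhds
    refine continuousAt_const.mul ((ContinuousAt.sub ?_ ?_).sub
      ((continuousAt_integral_line hU cFv hc1 hseg).add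
        (continuousAt_integral_line hU crv hct hseg)))
    · exact ContinuousAt.comp (f := fun y => y + t • w) (g := hv)
        (chv.continuousAt (hU.mem_nhds (hseg t right_mem_uIcc))) (by fun_prop)
    · exact chv.continuousAt (hU.mem_nhds hx)
  · filter_upwards [key.eventually_nhds, ht] with y hkey hseg
    refine HasLineDerivAt.congr_of_eventuallyEq ?_ hkey
    have h1 : HasLineDerivAt ℝ (fun y => h (y + t • w)) (hv (y + t • w)) y v := by
      have h3 := Dvh _ (hseg t right_mem_uIcc)
      simpa only [HasLineDerivAt, add_right_comm] using h3
    have h2 : HasLineDerivAt ℝ h (hv y) y v := Dvh y (by simpa using hseg 0 left_mem_uIcc)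
    exact HasDerivAt.const_mul _ ((HasDerivAt.sub h1 h2).sub
      (HasDerivAt.add (hasLineDerivAt_integral_line hU cF cFv DvF hc1 hseg)
        (hasLineDerivAt_integral_line hU cr crv Dvr hct hseg)))

end LineDerivatives

section AnalyticSystems

open Set Filter Topology

theorem hasFDerivAt_of_hasLineDerivOn_single {n : ℕ} {U : Set (Fin n → ℝ)} (hU : IsOpen U)
    {f : (Fin n → ℝ) → ℝ} {f' : Fin n → (Fin n → ℝ) → ℝ}
    (hf : ∀ k, HasLineDerivOn U (Pi.single k 1) f (f' k)) (cf : ∀ k, ContinuousOn (f' k) U)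
    {x : Fin n → ℝ} (hx : x ∈ U) :
    HasFDerivAt f (∑ k, f' k x • ContinuousLinearMap.proj (R := ℝ) (φ := fun _ => ℝ) k) x := by
  rw [hasFDerivAt_iff_isLittleO_nhds_zero, Asymptotics.isLittleO_iff]
  intro ε hε
  set η : ℝ := ε / (n + 1) with hη
  have hη0 : 0 < η := by positivity
  have hnear : ∀ᶠ y in 𝓝 x, y ∈ U ∧ ∀ k, |f' k y - f' k x| ≤ η := by
    refine (hU.eventually_mem hx).and (eventually_all.2 fun k => ?_)
    have := Metric.tendsto_nhds.1 ((cf k).continuousAt (hU.mem_nhds hx)) η hη0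
    filter_upwards [this] with y hy
    exact (Real.dist_eq _ _ ▸ hy).le
  obtain ⟨δ, hδ, hball⟩ := Metric.eventually_nhds_iff_ball.1 hnear
  have key : ∀ s : Finset (Fin n), ∀ v : Fin n → ℝ, x + v ∈ Metric.ball x δ →
      (∀ i ∉ s, v i = 0) → |f (x + v) - f x - ∑ k, f' k x * v k| ≤ s.card * η * ‖v‖ := by
    intro s
    induction s using Finset.induction_on with
    | empty =>
      intro v _ hv
      have : v = 0 := funext fun i => hv i (by simp)
      simp [this]
    | insert j s hj ih =>
      intro v hvδ hv
      set v₀ : Fin n → ℝ := Function.update v j 0 with hv₀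
      have hvn : ‖v‖ < δ := by simpa using hvδ
      have hsplit : ∀ τ : ℝ, ∀ i, (v₀ + τ • (Pi.single j (1 : ℝ) : Fin n → ℝ)) i =
          if i = j then τ else v i := by
        intro τ i
        by_cases hij : i = j
        · subst hij; simp [hv₀]
        · simp [hv₀, hij]
      have hnorm : ∀ τ : ℝ, |τ| ≤ |v j| →
          ‖v₀ + τ • (Pi.single j (1 : ℝ) : Fin n → ℝ)‖ ≤ ‖v‖ := by
        intro τ hτ
        refine (pi_norm_le_iff_of_nonneg (norm_nonneg _)).2 fun i => ?_
        rw [hsplit]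
        split_ifs with hij
        · exact hτ.trans (norm_le_pi_norm v j)
        · exact norm_le_pi_norm v i
      have hv₀n : ‖v₀‖ ≤ ‖v‖ := by simpa using hnorm 0 (by simp)
      have hv1 : v₀ + v j • (Pi.single j (1 : ℝ) : Fin n → ℝ) = v := by
        funext i
        rw [hsplit]
        split_ifs with hij
        · rw [hij]
        · rfl
      have h1 := ih v₀ (by simpa using hv₀n.trans_lt hvn) fun i hi => by
        by_cases hij : i = j
        · subst hij; simp [hv₀]
        · rw [hv₀, Function.update_of_ne hij]
          exact hv i (by simp [hij, hi])
      have hmem : ∀ τ ∈ uIcc 0 (v j),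
          x + v₀ + τ • (Pi.single j (1 : ℝ) : Fin n → ℝ) ∈ Metric.ball x δ := by
        intro τ hτ
        have h2 : |τ - 0| ≤ |v j - 0| := abs_sub_left_of_mem_uIcc hτ
        rw [sub_zero, sub_zero] at h2
        rw [add_assoc]
        simpa using (hnorm τ h2).trans_lt hvn
      have h2 := (convex_uIcc 0 (v j)).norm_image_sub_le_of_norm_hasDerivWithin_le (C := η)
        (f := fun τ : ℝ => f (x + v₀ + τ • (Pi.single j (1 : ℝ) : Fin n → ℝ)) - τ * f' j x)
        (f' := fun τ => f' j (x + v₀ + τ • (Pi.single j (1 : ℝ) : Fin n → ℝ)) - 1 * f' j x)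
        (fun τ hτ => (((hf j _ (hball _ (hmem τ hτ)).1).hasDerivAt_comp_line).sub
          ((hasDerivAt_id τ).mul_const _)).hasDerivWithinAt)
        (fun τ hτ => by
          simpa using (hball _ (hmem τ hτ)).2 j) left_mem_uIcc right_mem_uIcc
      rw [add_assoc, hv1] at h2
      simp only [zero_smul, add_zero, zero_mul, sub_zero, Real.norm_eq_abs] at h2
      have h3 : ∑ k, f' k x * v k = ∑ k, f' k x * v₀ k + v j * f' j x := by
        conv_lhs => rw [← hv1]
        simp only [Pi.add_apply, mul_add, Finset.sum_add_distrib, Pi.smul_apply, smul_eq_mul]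
        congr 1
        simp [Pi.single_apply, mul_comm]
      have h4 : |v j| ≤ ‖v‖ := norm_le_pi_norm v j
      have h5 : f (x + v) - f x - ∑ k, f' k x * v k =
          (f (x + v₀) - f x - ∑ k, f' k x * v₀ k) + (f (x + v) - v j * f' j x - f (x + v₀)) := by
        rw [h3]; ring
      rw [h5, Finset.card_insert_of_notMem hj]
      refine (abs_add_le _ _).trans ((add_le_add h1 h2).trans ?_)
      push_cast
      have h6 : (s.card : ℝ) * η * ‖v₀‖ ≤ s.card * η * ‖v‖ :=
        mul_le_mul_of_nonneg_left hv₀n (by positivity)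
      have h7 := mul_le_mul_of_nonneg_left h4 hη0.le
      linarith
  filter_upwards [Metric.ball_mem_nhds (0 : Fin n → ℝ) hδ] with v hv
  have h := key Finset.univ v (by simpa using hv) (by simp)
  have hcard : ((Finset.univ : Finset (Fin n)).card : ℝ) * η ≤ ε := by
    rw [Finset.card_univ, Fintype.card_fin, hη, mul_div_assoc', div_le_iff₀ (by positivity)]
    nlinarith
  have hsum : (∑ k, f' k x • ContinuousLinearMap.proj (R := ℝ) (φ := fun _ : Fin n => ℝ) k) v =
      ∑ k, f' k x * v k := by
    simp
  rw [hsum]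
  exact h.trans (mul_le_mul_of_nonneg_right hcard (norm_nonneg _))

/-- Integration from the left endpoint, as an operator on continuous functions on `[0, 1]`. -/
def volterra : C(unitInterval, ℝ) →L[ℝ] C(unitInterval, ℝ) :=
  LinearMap.mkContinuous
    { toFun := fun φ => ⟨fun t => ∫ s in (0 : ℝ)..t, φ (projIcc 0 1 zero_le_one s), by
        have h : Continuous fun s => φ (projIcc 0 1 zero_le_one s) :=
          φ.continuous.comp continuous_projIcc
        exact (intervalIntegral.continuous_primitive (fun a b => h.intervalIntegrable a b)
          0).comp continuous_subtype_val⟩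
      map_add' := fun φ χ => by
        ext t
        exact intervalIntegral.integral_add
          ((φ.continuous.comp continuous_projIcc).intervalIntegrable _ _)
          ((χ.continuous.comp continuous_projIcc).intervalIntegrable _ _)
      map_smul' := fun c φ => by
        ext t
        exact intervalIntegral.integral_const_mul c _ }
    1 fun φ => by
      rw [one_mul, ContinuousMap.norm_le _ (norm_nonneg _)]
      intro t
      refine (intervalIntegral.norm_integral_le_of_norm_le_const
        (fun s _ => φ.norm_coe_le_norm _)).trans ?_
      rw [sub_zero, abs_of_nonneg t.2.1]
      exact mul_le_of_le_one_right (norm_nonneg _) t.2.2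

theorem volterra_apply (φ : C(unitInterval, ℝ)) (t : unitInterval) :
    volterra φ t = ∫ s in (0 : ℝ)..t, φ (projIcc 0 1 zero_le_one s) := rfl

/-- Restricting an analytic function to the segments starting at a point gives a function analytic
in the direction of the segment, with values in `C([0, 1])`. -/
theorem AnalyticAt.exists_analyticAt_segment {E : Type*} [NormedAddCommGroup E] [NormedSpace ℝ E]
    {c : E → ℝ} {x : E} (hc : AnalyticAt ℝ c x) :
    ∃ m : E → C(unitInterval, ℝ), AnalyticAt ℝ m 0 ∧
      ∀ᶠ v in 𝓝 0, ∀ s : unitInterval, m v s = c (x + (s : ℝ) • v) := by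
  obtain ⟨p, r, hp⟩ := hc
  let S : ℕ → C(unitInterval, ℝ) := fun k => ⟨fun s => (s : ℝ) ^ k, by fun_prop⟩
  have hS : ∀ k, ‖S k‖ ≤ 1 := fun k => (ContinuousMap.norm_le _ zero_le_one).2 fun s => by
    have h0 : (0 : ℝ) ≤ s := s.2.1
    have h1 : (s : ℝ) ^ k ≤ 1 := pow_le_one₀ h0 s.2.2
    simpa [S, abs_of_nonneg h0] using h1
  let q : FormalMultilinearSeries ℝ E C(unitInterval, ℝ) := fun k =>
    (ContinuousLinearMap.toSpanSingleton ℝ (S k)).compContinuousMultilinearMap (p k)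
  have hqp : p.radius ≤ q.radius := FormalMultilinearSeries.radius_le_of_le fun k => by
    refine (ContinuousLinearMap.norm_compContinuousMultilinearMap_le _ _).trans ?_
    rw [ContinuousLinearMap.norm_toSpanSingleton]
    exact mul_le_of_le_one_left (norm_nonneg _) (hS k)
  have hq0 : 0 < q.radius := (hp.r_pos.trans_le hp.r_le).trans_le hqp
  have hq := q.hasFPowerSeriesOnBall hq0
  refine ⟨q.sum, hq.analyticAt, ?_⟩
  filter_upwards [Metric.eball_mem_nhds (0 : E) hp.r_pos] with v hv s
  have h1 : HasSum (fun k => q k fun _ => v) (q.sum v) := by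
    have := hq.hasSum (y := v) (Metric.eball_subset_eball (hp.r_le.trans hqp) hv)
    simpa using this
  have h2 := h1.mapL (ContinuousMap.evalCLM ℝ s)
  have hsv : (s : ℝ) • v ∈ Metric.eball (0 : E) r := by
    rw [mem_eball_zero_iff] at hv ⊢
    refine lt_of_le_of_lt ?_ hv
    rw [enorm_smul]
    refine mul_le_of_le_one_left' ?_
    rw [Real.enorm_eq_ofReal s.2.1]
    exact ENNReal.ofReal_le_one.2 s.2.2
  have h3 := hp.hasSum hsv
  refine h2.unique ?_
  refine h3.congr_fun fun k => ?_
  simp [q, S, mul_comm, ContinuousMultilinearMap.map_smul_univ]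

/-- A solution `w` of `w = u₀ + K(v) w`, where the operators `K(v)` depend analytically on `v` and
vanish for `v = 0`, depends analytically on `v`. -/
theorem analyticAt_of_fixed_point {E X : Type*} [NormedAddCommGroup E] [NormedSpace ℝ E]
    [NormedAddCommGroup X] [NormedSpace ℝ X] [CompleteSpace X] {K : E → X →L[ℝ] X}
    (hK : AnalyticAt ℝ K 0) (hK0 : K 0 = 0) {w : E → X} {u₀ : X}
    (hw : ∀ᶠ v in 𝓝 0, w v - K v (w v) = u₀) : AnalyticAt ℝ w 0 := by
  have hinv : AnalyticAt ℝ (fun v => Ring.inverse (1 - K v)) 0 := by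
    have h1 : AnalyticAt ℝ (fun A : X →L[ℝ] X => Ring.inverse (1 - A)) (K 0) := by
      rw [hK0]; exact analyticAt_inverse_one_sub ℝ (X →L[ℝ] X)
    exact h1.comp hK
  have hev : AnalyticAt ℝ (fun v => Ring.inverse (1 - K v) u₀) 0 :=
    ((ContinuousLinearMap.apply ℝ X u₀).analyticAt _).comp hinv
  have hunit : ∀ᶠ v in 𝓝 0, ‖K v‖ < 1 := by
    have h1 : Tendsto (fun v => ‖K v‖) (𝓝 0) (𝓝 0) := by
      simpa [hK0] using hK.continuousAt.norm.tendsto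
    exact h1.eventually (gt_mem_nhds zero_lt_one)
  refine hev.congr ?_
  filter_upwards [hunit, hw] with v hv1 hv2
  have hcancel : Ring.inverse (1 - K v) * (1 - K v) = 1 :=
    Ring.inverse_mul_cancel _ (isUnit_one_sub_of_norm_lt_one hv1)
  rw [← hv2]
  exact congrArg (fun A : X →L[ℝ] X => A (w v)) hcancel

/-- The integrated form of a linear system along the segments issuing from a point: its solutions
depend analytically on the direction of the segment. -/
theorem analyticAt_of_volterra_system {n : ℕ} {ι Y : Type*} [Fintype ι] [NormedCommRing Y]
    [NormedAlgebra ℝ Y] [CompleteSpace Y] (V : Y →L[ℝ] Y) {m : Fin n → ι → ι → (Fin n → ℝ) → Y}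
    (hm : ∀ k a b, AnalyticAt ℝ (m k a b) 0) {w : (Fin n → ℝ) → ι → Y} {u₀ : ι → Y}
    (hw : ∀ᶠ v in 𝓝 0, ∀ a, w v a - ∑ k, ∑ b, v k • V (m k a b v * w v b) = u₀ a) :
    AnalyticAt ℝ w 0 := by
  classical
  let T : ι → ι → Y →L[ℝ] (ι → Y) →L[ℝ] (ι → Y) := fun a b =>
    (ContinuousLinearMap.compL ℝ (ι → Y) Y (ι → Y)
      (ContinuousLinearMap.single ℝ (fun _ : ι => Y) a ∘L V)) ∘L
    ((ContinuousLinearMap.compL ℝ (ι → Y) Y Y).flip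
      (ContinuousLinearMap.proj (R := ℝ) (φ := fun _ : ι => Y) b)) ∘L
    (ContinuousLinearMap.mul ℝ Y)
  have hT : ∀ a b μ y, T a b μ y = Pi.single a (V (μ * y b)) := fun a b μ y => rfl
  refine analyticAt_of_fixed_point (u₀ := u₀)
    (K := fun v => ∑ k, ∑ a, ∑ b, v k • T a b (m k a b v)) ?_ ?_ ?_
  · refine Finset.analyticAt_fun_sum _ fun k _ => Finset.analyticAt_fun_sum _ fun a _ =>
      Finset.analyticAt_fun_sum _ fun b _ => AnalyticAt.fun_smul ?_ ?_
    · exact (ContinuousLinearMap.proj (R := ℝ) (φ := fun _ : Fin n => ℝ) k).analyticAt 0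
    · exact (ContinuousLinearMap.analyticAt (F := (ι → Y) →L[ℝ] (ι → Y)) (T a b) _).comp
        (hm k a b)
  · refine Finset.sum_eq_zero fun k _ => Finset.sum_eq_zero fun a _ =>
      Finset.sum_eq_zero fun b _ => zero_smul ℝ _
  · filter_upwards [hw] with v hv
    funext a
    rw [← hv a, Pi.sub_apply]
    congr 1
    simp only [sum_apply, smul_apply, hT, Finset.sum_apply, Pi.smul_apply]
    refine Finset.sum_congr rfl fun k _ => ?_
    rw [Finset.sum_eq_single a]
    · simp
    · intro e _ hea
      simp [Pi.single_eq_of_ne (Ne.symm hea)]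
    · simp

/-- A `C¹` solution of a closed linear first order system `∂_k u_a = ∑ c_{kab} u_b` with analytic
coefficients is analytic. -/
theorem analyticOnNhd_of_linear_system {n : ℕ} {ι : Type*} [Fintype ι] {U : Set (Fin n → ℝ)}
    (hU : IsOpen U) {u : ι → (Fin n → ℝ) → ℝ} (cu : ∀ a, ContinuousOn (u a) U)
    {c : Fin n → ι → ι → (Fin n → ℝ) → ℝ} (hc : ∀ k a b, AnalyticOnNhd ℝ (c k a b) U)
    (hu : ∀ k a, HasLineDerivOn U (Pi.single k 1) (u a) (fun x => ∑ b, c k a b x * u b x)) (a : ι) :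
    AnalyticOnNhd ℝ (u a) U := by
  intro x hx
  choose m hm hmeq using fun k a b => (hc k a b x hx).exists_analyticAt_segment
  have heq : ∀ᶠ v in 𝓝 0, ∀ k a b, ∀ s : unitInterval,
      m k a b v s = c k a b (x + (s : ℝ) • v) := by
    simpa only [eventually_all] using hmeq
  obtain ⟨ρ, hρ, hball⟩ := Metric.isOpen_iff.1 hU x hx
  have hseg : ∀ v : Fin n → ℝ, v ∈ Metric.ball 0 ρ → ∀ s ∈ Icc (0 : ℝ) 1, x + s • v ∈ U := by
    intro v hv s hs
    refine hball ?_
    have : ‖s • v‖ < ρ := by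
      rw [norm_smul, Real.norm_of_nonneg hs.1]
      exact (mul_le_of_le_one_left (norm_nonneg _) hs.2).trans_lt (by simpa using hv)
    simpa using this
  classical
  let w : (Fin n → ℝ) → ι → C(unitInterval, ℝ) := fun v b =>
    if hv : v ∈ Metric.ball 0 ρ then ⟨fun s => u b (x + (s : ℝ) • v),
      (cu b).comp_continuous (by fun_prop) fun s => hseg v hv s s.2⟩ else 0
  have hwv : ∀ v ∈ Metric.ball (0 : Fin n → ℝ) ρ, ∀ b (s : unitInterval),
      w v b s = u b (x + (s : ℝ) • v) := fun v hv b s => by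
    simp only [w, dif_pos hv]; rfl
  have hw : AnalyticAt ℝ w 0 := by
    refine analyticAt_of_volterra_system volterra hm
      (u₀ := fun b => ContinuousMap.const _ (u b x)) ?_
    filter_upwards [heq, Metric.ball_mem_nhds (0 : Fin n → ℝ) hρ] with v hv2 hv3 b
    ext t
    have hsub : ∀ s ∈ uIcc 0 (t : ℝ), s ∈ Icc (0 : ℝ) 1 := fun s hs => by
      rw [uIcc_of_le t.2.1] at hs
      exact ⟨hs.1, hs.2.trans t.2.2⟩
    have hcc : ∀ k d, ContinuousOn (fun x => c k b d x * u d x) U := fun k d =>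
      (hc k b d).continuousOn.mul (cu d)
    have hcl : ∀ k d, ContinuousOn
        (fun s : ℝ => v k * (c k b d (x + s • v) * u d (x + s • v))) (uIcc 0 (t : ℝ)) :=
      fun k d => continuousOn_const.mul
        ((hcc k d).comp (f := fun s : ℝ => x + s • v) (by fun_prop)
          fun s hs => hseg v hv3 s (hsub s hs))
    have hderiv : ∀ s ∈ uIcc 0 (t : ℝ), HasDerivAt (fun s : ℝ => u b (x + s • v))
        (∑ k, ∑ d, v k * (c k b d (x + s • v) * u d (x + s • v))) s := by
      intro s hs
      have h1 := hasFDerivAt_of_hasLineDerivOn_single hU (fun k => hu k b)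
        (fun k => continuousOn_finsetSum _ fun d _ => hcc k d) (hseg v hv3 s (hsub s hs))
      have h2 : HasDerivAt (fun s : ℝ => x + s • v) v s := by
        simpa using ((hasDerivAt_id s).smul_const v).const_add x
      refine (h1.comp_hasDerivAt s h2).congr_deriv ?_
      simp only [sum_apply, smul_apply,
        ContinuousLinearMap.proj_apply, smul_eq_mul, Finset.sum_mul]
      exact Finset.sum_congr rfl fun k _ => Finset.sum_congr rfl fun d _ => by ring
    have hclk : ∀ k, ContinuousOn
        (fun s : ℝ => ∑ d, v k * (c k b d (x + s • v) * u d (x + s • v))) (uIcc 0 (t : ℝ)) :=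
      fun k => continuousOn_finsetSum _ fun d _ => hcl k d
    have hint := intervalIntegral.integral_eq_sub_of_hasDerivAt hderiv
      (ContinuousOn.intervalIntegrable (continuousOn_finsetSum _ fun k _ => hclk k))
    rw [intervalIntegral.integral_finsetSum fun k _ => (hclk k).intervalIntegrable] at hint
    have hV : ∀ k d, volterra (m k b d v * w v d) t =
        ∫ s in (0 : ℝ)..t, c k b d (x + s • v) * u d (x + s • v) := fun k d => by
      rw [volterra_apply]
      refine intervalIntegral.integral_congr fun s hs => ?_
      simp [hv2, hwv v hv3, projIcc_of_mem zero_le_one (hsub s hs)]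
    have hsum : ∑ k, ∑ d, v k * volterra (m k b d v * w v d) t =
        u b (x + (t : ℝ) • v) - u b x := by
      simp only [zero_smul, add_zero] at hint
      rw [← hint]
      refine Finset.sum_congr rfl fun k _ => ?_
      rw [intervalIntegral.integral_finsetSum fun d _ => (hcl k d).intervalIntegrable]
      exact Finset.sum_congr rfl fun d _ => by
        rw [hV, intervalIntegral.integral_const_mul]
    simp only [ContinuousMap.sub_apply, ContinuousMap.sum_apply, ContinuousMap.smul_apply,
      ContinuousMap.const_apply, smul_eq_mul, hsum, hwv v hv3]
    ring
  have h0 : AnalyticAt ℝ (fun v => u a (x + v)) 0 := by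
    have hev := (((ContinuousMap.evalCLM ℝ (1 : unitInterval)) ∘L
      (ContinuousLinearMap.proj (R := ℝ) (φ := fun _ : ι => C(unitInterval, ℝ)) a)).analyticAt
        (w 0)).comp hw
    refine hev.congr ?_
    filter_upwards [Metric.ball_mem_nhds (0 : Fin n → ℝ) hρ] with v hv
    simpa using hwv v hv a 1
  have h1 : AnalyticAt ℝ (fun v => u a (x + v)) (x - x) := by rwa [sub_self]
  have h2 := h1.comp (f := fun y => y - x) (analyticAt_id.sub analyticAt_const)
  refine h2.congr (Eventually.of_forall fun y => ?_)
  simp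

end AnalyticSystems

section Prolongation

open Set Filter Topology

variable {E : Type*} [NormedAddCommGroup E] [NormedSpace ℝ E]

theorem HasLineDerivOn.const_mul {U : Set E} {v : E} {f f' : E → ℝ} (a : ℝ)
    (hf : HasLineDerivOn U v f f') : HasLineDerivOn U v (fun x => a * f x) (fun x => a * f' x) :=
  fun x hx => HasDerivAt.const_mul a (hf x hx)

theorem HasLineDerivOn.eqOn {U : Set E} {v : E} {f f₁ f₂ : E → ℝ}
    (h₁ : HasLineDerivOn U v f f₁) (h₂ : HasLineDerivOn U v f f₂) : EqOn f₁ f₂ U :=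
  fun x hx => (h₁ x hx).unique (h₂ x hx)

theorem AnalyticOnNhd.exists_hasLineDerivOn {U : Set E} {f : E → ℝ}
    (hf : AnalyticOnNhd ℝ f U) (v : E) :
    ∃ f', AnalyticOnNhd ℝ f' U ∧ HasLineDerivOn U v f f' :=
  ⟨fun x => fderiv ℝ f x v,
    fun x hx => ((ContinuousLinearMap.apply ℝ ℝ v).analyticAt _).comp (hf x hx).fderiv,
    fun x hx => (hf x hx).differentiableAt.hasFDerivAt.hasLineDerivAt v⟩

/-- Functions which on `U` are linear combinations of members of `S` with coefficients analytic
on `U`. -/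
inductive AnalyticSpan (U : Set E) (S : Set (E → ℝ)) : (E → ℝ) → Prop
  | of {f : E → ℝ} (hf : f ∈ S) : AnalyticSpan U S f
  | zero : AnalyticSpan U S fun _ => 0
  | add {f g : E → ℝ} (hf : AnalyticSpan U S f) (hg : AnalyticSpan U S g) :
      AnalyticSpan U S fun x => f x + g x
  | mul {c f : E → ℝ} (hc : AnalyticOnNhd ℝ c U) (hf : AnalyticSpan U S f) :
      AnalyticSpan U S fun x => c x * f x
  | congr {f g : E → ℝ} (hf : AnalyticSpan U S f) (hfg : EqOn f g U) : AnalyticSpan U S g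

namespace AnalyticSpan

variable {U : Set E} {S T : Set (E → ℝ)} {f g : E → ℝ}

theorem mono (hST : S ⊆ T) (hf : AnalyticSpan U S f) : AnalyticSpan U T f := by
  induction hf with
  | of hf => exact .of (hST hf)
  | zero => exact .zero
  | add _ _ ihf ihg => exact .add ihf ihg
  | mul hc _ ih => exact .mul hc ih
  | congr _ hfg ih => exact .congr ih hfg

theorem const_mul (a : ℝ) (hf : AnalyticSpan U S f) : AnalyticSpan U S fun x => a * f x :=
  .mul analyticOnNhd_const hf

theorem sub (hf : AnalyticSpan U S f) (hg : AnalyticSpan U S g) :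
    AnalyticSpan U S fun x => f x - g x :=
  (hf.add (hg.const_mul (-1))).congr fun x _ => by ring

theorem sum {κ : Type*} {s : Finset κ} {F : κ → E → ℝ} (hF : ∀ a ∈ s, AnalyticSpan U S (F a)) :
    AnalyticSpan U S fun x => ∑ a ∈ s, F a x := by
  classical
  induction s using Finset.induction_on with
  | empty => simpa using AnalyticSpan.zero
  | insert a s ha ih =>
    simp only [Finset.sum_insert ha]
    exact .add (hF a (by simp)) (ih fun b hb => hF b (by simp [hb]))

theorem continuousOn (hS : ∀ s ∈ S, ContinuousOn s U) (hf : AnalyticSpan U S f) :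
    ContinuousOn f U := by
  induction hf with
  | of hf => exact hS _ hf
  | zero => exact continuousOn_const
  | add _ _ ihf ihg => exact ihf.add ihg
  | mul hc _ ih => exact hc.continuousOn.mul ih
  | congr _ hfg ih => exact ih.congr hfg.symm

theorem exists_hasLineDerivOn (hU : IsOpen U) {v : E} (hST : S ⊆ T)
    (hS : ∀ s ∈ S, ∃ s', HasLineDerivOn U v s s' ∧ AnalyticSpan U T s')
    (hf : AnalyticSpan U S f) : ∃ f', HasLineDerivOn U v f f' ∧ AnalyticSpan U T f' := by
  induction hf with
  | of hf => exact hS _ hf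
  | zero => exact ⟨fun _ => 0, fun x _ => hasDerivAt_const _ _, .zero⟩
  | add _ _ ihf ihg =>
    obtain ⟨f', hf', sf'⟩ := ihf
    obtain ⟨g', hg', sg'⟩ := ihg
    exact ⟨_, hf'.add hg', sf'.add sg'⟩
  | mul hc hf ih =>
    obtain ⟨c', hc', dc'⟩ := hc.exists_hasLineDerivOn v
    obtain ⟨f', hf', sf'⟩ := ih
    exact ⟨_, dc'.mul hf', (hf.mono hST |>.mul hc').add (sf'.mul hc)⟩
  | congr _ hfg ih =>
    obtain ⟨f', hf', sf'⟩ := ih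
    exact ⟨f', hf'.congr hU hfg fun _ _ => rfl, sf'⟩

theorem exists_eqOn_of_insert {p : E → ℝ} (hf : AnalyticSpan U (insert p S) f) :
    ∃ α r, AnalyticOnNhd ℝ α U ∧ AnalyticSpan U S r ∧ EqOn f (fun x => α x * p x + r x) U := by
  induction hf with
  | of hf =>
    rcases hf with rfl | hf
    · exact ⟨fun _ => 1, fun _ => 0, analyticOnNhd_const, .zero, fun x _ => by simp⟩
    · exact ⟨fun _ => 0, _, analyticOnNhd_const, .of hf, fun x _ => by simp⟩
  | zero => exact ⟨fun _ => 0, fun _ => 0, analyticOnNhd_const, .zero, fun x _ => by simp⟩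
  | add _ _ ihf ihg =>
    obtain ⟨α, r, hα, hr, h⟩ := ihf
    obtain ⟨β, s, hβ, hs, h'⟩ := ihg
    exact ⟨fun x => α x + β x, _, hα.add hβ, hr.add hs, fun x hx => by
      simp only [h hx, h' hx]; ring⟩
  | mul hc _ ih =>
    obtain ⟨α, r, hα, hr, h⟩ := ih
    exact ⟨_, _, hc.mul hα, hr.mul hc, fun x hx => by
      simp only [h hx]; ring⟩
  | congr _ hfg ih =>
    obtain ⟨α, r, hα, hr, h⟩ := ih
    exact ⟨α, r, hα, hr, hfg.symm.trans h⟩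

theorem exists_eqOn_sum {ι : Type*} [Fintype ι] {u : ι → E → ℝ}
    (hf : AnalyticSpan U (range u) f) :
    ∃ c : ι → E → ℝ, (∀ a, AnalyticOnNhd ℝ (c a) U) ∧ EqOn f (fun x => ∑ a, c a x * u a x) U := by
  classical
  induction hf with
  | of hf =>
    obtain ⟨a, rfl⟩ := hf
    exact ⟨fun b _ => if b = a then 1 else 0, fun b => analyticOnNhd_const, fun x _ => by simp⟩
  | zero => exact ⟨fun _ _ => 0, fun _ => analyticOnNhd_const, fun x _ => by simp⟩
  | add _ _ ihf ihg =>
    obtain ⟨c, hc, h⟩ := ihf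
    obtain ⟨d, hd, h'⟩ := ihg
    exact ⟨fun a x => c a x + d a x, fun a => (hc a).add (hd a), fun x hx => by
      simp only [h hx, h' hx, add_mul, Finset.sum_add_distrib]⟩
  | @mul e f he _ ih =>
    obtain ⟨c, hc, h⟩ := ih
    exact ⟨fun a x => e x * c a x, fun a => he.mul (hc a), fun x hx => by
      simp only [h hx, Finset.mul_sum, mul_assoc]⟩
  | congr _ hfg ih =>
    obtain ⟨c, hc, h⟩ := ih
    exact ⟨c, hc, hfg.symm.trans h⟩

end AnalyticSpan

/-- Solutions of the linear system `∂_k σ^{ij} = δ_k^i λ^j + δ_k^j λ^i + L_k^{ij}(σ)`, whose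
zeroth order part `L` has analytic coefficients, are analytic. -/
theorem analyticOnNhd_of_metrizability_system {n : ℕ} (hn : 2 ≤ n) {U : Set (Fin n → ℝ)}
    (hU : IsOpen U) {σ : Fin n → Fin n → (Fin n → ℝ) → ℝ} {l : Fin n → (Fin n → ℝ) → ℝ}
    {L : Fin n → Fin n → Fin n → (Fin n → ℝ) → ℝ}
    (cσ : ∀ i j, ContinuousOn (σ i j) U) (cl : ∀ i, ContinuousOn (l i) U)
    (hL : ∀ k i j, AnalyticSpan U (range fun p : Fin n × Fin n => σ p.1 p.2) (L k i j))
    (hσ : ∀ k i j, HasLineDerivOn U (Pi.single k 1) (σ i j) fun x =>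
      (if k = i then l j x else 0) + (if k = j then l i x else 0) + L k i j x) :
    ∀ i j, AnalyticOnNhd ℝ (σ i j) U := by
  set S₀ : Set ((Fin n → ℝ) → ℝ) := range fun p : Fin n × Fin n => σ p.1 p.2 with hS₀
  set S₁ : Set ((Fin n → ℝ) → ℝ) := S₀ ∪ range l with hS₁
  have memσ : ∀ i j, σ i j ∈ S₀ := fun i j => ⟨(i, j), rfl⟩
  have S₀₁ : S₀ ⊆ S₁ := subset_union_left
  have meml : ∀ i, l i ∈ S₁ := fun i => Or.inr ⟨i, rfl⟩
  have cS₁ : ∀ s ∈ S₁, ContinuousOn s U := by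
    rintro s (⟨p, rfl⟩ | ⟨i, rfl⟩)
    · exact cσ _ _
    · exact cl i
  have dσ : ∀ k, ∀ s ∈ S₀, ∃ s', HasLineDerivOn U (Pi.single k 1) s s' ∧ AnalyticSpan U S₁ s' := by
    rintro k s ⟨⟨i, j⟩, rfl⟩
    refine ⟨_, hσ k i j, .add (.add ?_ ?_) ((hL k i j).mono S₀₁)⟩
    · split_ifs
      exacts [.of (meml j), .zero]
    · split_ifs
      exacts [.of (meml i), .zero]
  have dS₀ : ∀ k f, AnalyticSpan U S₀ f →
      ∃ f', HasLineDerivOn U (Pi.single k 1) f f' ∧ AnalyticSpan U S₁ f' := fun k f hf =>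
    hf.exists_hasLineDerivOn hU S₀₁ (dσ k)
  have cS₀ : ∀ f, AnalyticSpan U S₀ f → ContinuousOn f U := fun f hf =>
    (hf.mono S₀₁).continuousOn cS₁
  have dσfst : ∀ i j, i ≠ j →
      HasLineDerivOn U (Pi.single i 1) (σ i j) fun x => l j x + L i i j x := fun i j hij =>
    (hσ i i j).congr hU (fun _ _ => rfl) fun x _ => by simp [hij]
  have dσsnd : ∀ i j, i ≠ j →
      HasLineDerivOn U (Pi.single j 1) (σ i j) fun x => l i x + L j i j x := fun i j hij =>
    (hσ j i j).congr hU (fun _ _ => rfl) fun x _ => by simp [hij.symm]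
  -- the off-diagonal derivatives of `λ`
  have offdiag : ∀ i j, i ≠ j →
      ∃ P, HasLineDerivOn U (Pi.single j 1) (l i) P ∧ AnalyticSpan U S₁ P := by
    intro i j hij
    have hi : HasLineDerivOn U (Pi.single i 1) (σ i i) fun x => l i x + l i x + L i i i x :=
      (hσ i i i).congr hU (fun _ _ => rfl) fun x _ => by simp
    have hj : HasLineDerivOn U (Pi.single j 1) (σ i i) (L j i i) :=
      (hσ j i i).congr hU (fun _ _ => rfl) fun x _ => by simp [hij.symm]
    obtain ⟨A, dA, sA⟩ := dS₀ i _ (hL j i i)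
    obtain ⟨B, dB, sB⟩ := dS₀ j _ (hL i i i)
    have h := hi.swap hU hj dA (cS₀ _ (hL j i i)) (sA.continuousOn cS₁)
    refine ⟨_, ((h.sub dB).const_mul (1 / 2)).congr hU (fun x _ => ?_) (fun _ _ => rfl),
      (sA.sub sB).const_mul (1 / 2)⟩
    ring
  have exists_ne : ∀ i : Fin n, ∃ j, i ≠ j := fun i => by
    have : Nontrivial (Fin n) := Fin.nontrivial_iff_two_le.2 hn
    exact (exists_ne i).imp fun _ h => h.symm
  -- the diagonal derivatives of `λ` exist
  have diag : ∀ i, ∃ m, ContinuousOn m U ∧ HasLineDerivOn U (Pi.single i 1) (l i) m := by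
    intro i
    obtain ⟨j, hij⟩ := exists_ne i
    obtain ⟨P, dP, sP⟩ := offdiag i j hij
    have hsub : S₁ ⊆ insert (l i) (S₀ ∪ l '' {k | k ≠ i}) := by
      rintro s (hs | ⟨k, rfl⟩)
      · exact Or.inr (Or.inl hs)
      · by_cases hk : k = i
        · exact Or.inl (by rw [hk])
        · exact Or.inr (Or.inr ⟨k, hk, rfl⟩)
    obtain ⟨α, r, hα, sr, hP⟩ := (sP.mono hsub).exists_eqOn_of_insert
    have hsub' : S₀ ∪ l '' {k | k ≠ i} ⊆ S₁ :=
      union_subset_union_right _ (image_subset_range _ _)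
    obtain ⟨r', dr', sr'⟩ := sr.exists_hasLineDerivOn hU (v := Pi.single i 1) hsub' (by
      rintro s (hs | ⟨k, hk, rfl⟩)
      · exact dσ i s hs
      · exact offdiag k i hk)
    obtain ⟨α', hα', dα'⟩ := hα.exists_hasLineDerivOn (Pi.single j 1)
    obtain ⟨αi, hαi, dαi⟩ := hα.exists_hasLineDerivOn (Pi.single i 1)
    have sh : AnalyticSpan U S₀ (σ i j) := .of (memσ i j)
    have sF := (hL j i j).add (sh.mul hα)
    have sq := (sh.mul hα').add ((hL j i j).mul hα)
    obtain ⟨F', dF', sF'⟩ := dS₀ i _ sF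
    obtain ⟨q', dq', sq'⟩ := dS₀ i _ sq
    obtain ⟨p', cp', dp'⟩ := exists_hasLineDerivOn_of_second_order hU
      (v := Pi.single i 1) (w := Pi.single j 1) (h := σ i j)
      (p := fun x => l i x - α x * σ i j x)
      ((dσsnd i j hij).congr hU (fun _ _ => rfl)
        (g' := fun x => l i x - α x * σ i j x + (L j i j x + α x * σ i j x))
        fun x _ => by simp)
      (dσfst i j hij)
      ((dP.sub (dα'.mul (dσsnd i j hij))).congr hU (fun _ _ => rfl)
        (g' := fun x => r x - (α' x * σ i j x + α x * L j i j x))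
        fun x hx => by simp only [hP hx]; ring)
      dF' (dr'.sub dq') ((cl j).add (cS₀ _ (hL i i j))) (cS₀ _ sF) (sF'.continuousOn cS₁)
      (((sr.mono hsub').continuousOn cS₁).sub (cS₀ _ sq))
      ((sr'.continuousOn cS₁).sub (sq'.continuousOn cS₁))
    refine ⟨_, cp'.add ((hαi.continuousOn.mul (cσ i j)).add
        (hα.continuousOn.mul ((cl j).add (cS₀ _ (hL i i j))))),
      (dp'.add (dαi.mul (dσfst i j hij))).congr hU (fun x _ => by simp) (fun _ _ => rfl)⟩
  choose m cm dm using diag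
  have diag_eq : ∀ i j, i ≠ j → ∃ R, AnalyticSpan U S₁ R ∧ EqOn (m j) (fun x => m i x + R x) U := by
    intro i j hij
    obtain ⟨A, dA, sA⟩ := dS₀ i _ (hL j i j)
    obtain ⟨B, dB, sB⟩ := dS₀ j _ (hL i i j)
    have h := (dσfst i j hij).swap hU (dσsnd i j hij) ((dm i).add dA)
      ((cl i).add (cS₀ _ (hL j i j))) ((cm i).add (sA.continuousOn cS₁))
    refine ⟨_, sA.sub sB, fun x hx => ?_⟩
    have h' : m i x + A x = m j x + B x := h.eqOn ((dm j).add dB) hx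
    simp only
    linarith
  -- the closed system for `σ`, `λ` and `μ`
  let o : Fin n := ⟨0, by lia⟩
  let u : (Fin n × Fin n) ⊕ Fin n ⊕ Unit → (Fin n → ℝ) → ℝ :=
    Sum.elim (fun p => σ p.1 p.2) (Sum.elim l fun _ => m o)
  have S₁u : S₁ ⊆ range u := by
    rintro s (⟨p, rfl⟩ | ⟨i, rfl⟩)
    · exact ⟨Sum.inl p, rfl⟩
    · exact ⟨Sum.inr (Sum.inl i), rfl⟩
  have memo : AnalyticSpan U (range u) (m o) := .of ⟨Sum.inr (Sum.inr ()), rfl⟩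
  have cu : ∀ a, ContinuousOn (u a) U := by
    rintro (p | i | _)
    exacts [cσ _ _, cl i, cm o]
  have cu' : ∀ s ∈ range u, ContinuousOn s U := by
    rintro s ⟨a, rfl⟩
    exact cu a
  have sm : ∀ i, AnalyticSpan U (range u) (m i) := by
    intro i
    by_cases hi : o = i
    · rw [← hi]; exact memo
    · obtain ⟨R, sR, hR⟩ := diag_eq o i hi
      exact (memo.add (sR.mono S₁u)).congr hR.symm
  have dl : ∀ k i, ∃ s', HasLineDerivOn U (Pi.single k 1) (l i) s' ∧
      AnalyticSpan U (range u) s' := by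
    intro k i
    by_cases hik : i = k
    · subst hik; exact ⟨_, dm i, sm i⟩
    · obtain ⟨P, dP, sP⟩ := offdiag i k hik
      exact ⟨P, dP, sP.mono S₁u⟩
  have dS₁ : ∀ k f, AnalyticSpan U S₁ f →
      ∃ f', HasLineDerivOn U (Pi.single k 1) f f' ∧ AnalyticSpan U (range u) f' := by
    intro k f hf
    refine hf.exists_hasLineDerivOn hU S₁u ?_
    rintro s (hs | ⟨i, rfl⟩)
    · obtain ⟨s', ds', ss'⟩ := dσ k s hs
      exact ⟨s', ds', ss'.mono S₁u⟩
    · exact dl k i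
  have dm_off : ∀ i k, i ≠ k → ∃ Q, HasLineDerivOn U (Pi.single k 1) (m i) Q ∧
      AnalyticSpan U (range u) Q := by
    intro i k hik
    obtain ⟨P, dP, sP⟩ := offdiag i k hik
    obtain ⟨Q, dQ, sQ⟩ := dS₁ i P sP
    exact ⟨Q, (dm i).swap hU dP dQ (sP.continuousOn cS₁) (sQ.continuousOn cu'), sQ⟩
  have du : ∀ k a, ∃ s', HasLineDerivOn U (Pi.single k 1) (u a) s' ∧
      AnalyticSpan U (range u) s' := by
    rintro k (p | i | _)
    · obtain ⟨s', ds', ss'⟩ := dσ k _ (memσ p.1 p.2)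
      exact ⟨s', ds', ss'.mono S₁u⟩
    · exact dl k i
    · by_cases hk : o = k
      · obtain ⟨j, hj⟩ := exists_ne o
        obtain ⟨R, sR, hR⟩ := diag_eq o j hj
        obtain ⟨R', dR', sR'⟩ := dS₁ o R sR
        obtain ⟨Q, dQ, sQ⟩ := dm_off j o hj.symm
        subst hk
        exact ⟨_, (dQ.sub dR').congr hU (fun x hx => by simp [hR hx, u]) (fun _ _ => rfl),
          sQ.sub sR'⟩
      · exact dm_off o k hk
  choose u' du' su' using du
  choose c hc hcu using fun k a => (su' k a).exists_eqOn_sum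
  intro i j
  exact analyticOnNhd_of_linear_system hU cu hc
    (fun k a => (du' k a).congr hU (fun _ _ => rfl) (hcu k a)) (Sum.inl (i, j))

end Prolongation

section MatrixCalculus

open Set Filter Topology

open Matrix

variable {ι : Type*} [Fintype ι] [DecidableEq ι]

/-- Jacobi's formula for the derivative of a determinant. -/
theorem HasDerivAt.matrix_det {M : ℝ → Matrix ι ι ℝ} {M' : Matrix ι ι ℝ} {t : ℝ}
    (hM : ∀ i j, HasDerivAt (fun s => M s i j) (M' i j) t) :
    HasDerivAt (fun s => (M s).det) ((M t).adjugate * M').trace t := by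
  have key : ((M t).adjugate * M').trace = ∑ σ : Equiv.Perm ι,
      (Equiv.Perm.sign σ : ℤ) * ∑ i, (∏ j ∈ Finset.univ.erase i, M t (σ j) j) * M' (σ i) i := by
    simp only [Finset.mul_sum]
    rw [Finset.sum_comm]
    refine Finset.sum_congr rfl fun i _ => ?_
    have hi : ((M t).adjugate * M').diag i = ((M t).updateCol i fun r => M' r i).det := by
      rw [← cramer_apply, cramer_eq_adjugate_mulVec]
      rfl
    rw [hi, det_apply']
    refine Finset.sum_congr rfl fun σ _ => ?_
    rw [← Finset.prod_erase_mul _ _ (Finset.mem_univ i)]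
    simp only [updateCol_self]
    congr 2
    exact Finset.prod_congr rfl fun j hj => by simp [updateCol_ne (Finset.ne_of_mem_erase hj)]
  rw [key]
  simp only [det_apply']
  refine HasDerivAt.fun_sum fun σ _ => HasDerivAt.const_mul _ ?_
  simpa using HasDerivAt.fun_finsetProd (u := Finset.univ) fun j _ => hM (σ j) j

theorem HasDerivAt.matrix_inv {M : ℝ → Matrix ι ι ℝ} {M' : Matrix ι ι ℝ} {t : ℝ}
    (hM : ∀ i j, HasDerivAt (fun s => M s i j) (M' i j) t) (ht : IsUnit (M t).det) (i j : ι) :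
    HasDerivAt (fun s => (M s)⁻¹ i j) ((-((M t)⁻¹ * M' * (M t)⁻¹)) i j) t := by
  have hdet := HasDerivAt.matrix_det hM
  have hadj : ∀ i j, DifferentiableAt ℝ (fun s => (M s).adjugate i j) t := by
    intro i j
    simp only [adjugate_apply]
    refine (HasDerivAt.matrix_det (M' := M'.updateRow j 0) fun r c => ?_).differentiableAt
    by_cases hr : r = j
    · subst hr
      simpa using hasDerivAt_const t _
    · simpa [updateRow_ne hr] using hM r c
  have hinv : ∀ i j, DifferentiableAt ℝ (fun s => (M s)⁻¹ i j) t := by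
    intro i j
    simp only [inv_def, Ring.inverse_eq_inv', Matrix.smul_apply, smul_eq_mul]
    exact (hdet.differentiableAt.inv ht.ne_zero).mul (hadj i j)
  obtain ⟨N', hN'⟩ : ∃ N' : Matrix ι ι ℝ, ∀ i j, HasDerivAt (fun s => (M s)⁻¹ i j) (N' i j) t :=
    ⟨of fun i j => _root_.deriv (fun s => (M s)⁻¹ i j) t, fun i j => (hinv i j).hasDerivAt⟩
  have hzero : M' * (M t)⁻¹ + M t * N' = 0 := by
    ext a b
    have h1 : HasDerivAt (fun s => (M s * (M s)⁻¹) a b) ((M' * (M t)⁻¹ + M t * N') a b) t := by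
      simp only [mul_apply, Matrix.add_apply, ← Finset.sum_add_distrib]
      exact HasDerivAt.fun_sum fun c _ => (hM a c).mul (hN' c b)
    have h2 : (fun s => (M s * (M s)⁻¹) a b) =ᶠ[𝓝 t] fun _ => (1 : Matrix ι ι ℝ) a b := by
      filter_upwards [hdet.continuousAt.eventually_ne ht.ne_zero] with s hs
      rw [mul_nonsing_inv _ (isUnit_iff_ne_zero.2 hs)]
    exact h1.unique ((hasDerivAt_const t _).congr_of_eventuallyEq h2)
  have : N' = -((M t)⁻¹ * M' * (M t)⁻¹) := by
    rw [← nonsing_inv_mul_cancel_left (M t) N' ht, eq_neg_of_add_eq_zero_right hzero,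
      Matrix.mul_neg, Matrix.mul_assoc]
  exact this ▸ hN' i j

variable {E : Type*} [NormedAddCommGroup E] [NormedSpace ℝ E]

theorem AnalyticAt.matrix_det {M : E → Matrix ι ι ℝ} {x : E}
    (hM : ∀ i j, AnalyticAt ℝ (fun y => M y i j) x) : AnalyticAt ℝ (fun y => (M y).det) x := by
  simp only [det_apply']
  exact Finset.analyticAt_fun_sum _ fun σ _ =>
    analyticAt_const.mul (Finset.analyticAt_fun_prod _ fun j _ => hM (σ j) j)

theorem AnalyticAt.matrix_inv {M : E → Matrix ι ι ℝ} {x : E}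
    (hM : ∀ i j, AnalyticAt ℝ (fun y => M y i j) x) (hx : IsUnit (M x).det) (i j : ι) :
    AnalyticAt ℝ (fun y => (M y)⁻¹ i j) x := by
  simp only [inv_def, Ring.inverse_eq_inv', Matrix.smul_apply, smul_eq_mul, adjugate_apply]
  refine ((AnalyticAt.matrix_det hM).inv hx.ne_zero).mul (AnalyticAt.matrix_det fun r c => ?_)
  by_cases hr : r = j
  · subst hr
    simpa using analyticAt_const
  · simpa [updateRow_ne hr] using hM r c

theorem ContinuousOn.matrix_inv {X : Type*} [TopologicalSpace X] {M : X → Matrix ι ι ℝ} {U : Set X}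
    (hM : ContinuousOn M U) (hU : ∀ x ∈ U, IsUnit (M x).det) : ContinuousOn (fun x => (M x)⁻¹) U := by
  simp only [inv_def, Ring.inverse_eq_inv']
  exact ((continuous_id.matrix_det.comp_continuousOn hM).inv₀ fun x hx => (hU x hx).ne_zero).smul
    (continuous_id.matrix_adjugate.comp_continuousOn hM)

end MatrixCalculus

section GeodesicMappings

open Set Filter Topology Matrix

variable {n : ℕ} {U : Set (Fin n → ℝ)} {g : Fin n → Fin n → (Fin n → ℝ) → ℝ}

theorem analyticAt_abs {t : ℝ} (ht : t ≠ 0) : AnalyticAt ℝ (fun s : ℝ => |s|) t := by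
  rcases lt_or_gt_of_ne ht with h | h
  · exact analyticAt_id.neg.congr <| (eventually_lt_nhds h).mono fun s hs => (abs_of_neg hs).symm
  · exact analyticAt_id.congr <| (eventually_gt_nhds h).mono fun s hs => (abs_of_pos hs).symm

namespace IsMetric

theorem continuousOn_matAt (hg : IsMetric 1 g U) : ContinuousOn (matAt g) U :=
  continuousOn_pi.2 fun i => continuousOn_pi.2 fun j => (hg.contDiff i j).continuousOn

theorem transpose_matAt (hg : IsMetric 1 g U) {x : Fin n → ℝ} (hx : x ∈ U) :
    (matAt g x)ᵀ = matAt g x := by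
  ext i j
  exact hg.symm j i x hx

theorem ginv_symm (hg : IsMetric 1 g U) (i j : Fin n) {x : Fin n → ℝ} (hx : x ∈ U) :
    ginv g i j x = ginv g j i x := by
  have h := transpose_nonsing_inv (matAt g x)
  rw [hg.transpose_matAt hx] at h
  exact congrFun (congrFun h j) i

theorem pd_symm_s2 (hU : IsOpen U) (hg : IsMetric 1 g U) (k i j : Fin n) {x : Fin n → ℝ}
    (hx : x ∈ U) : pd k (g i j) x = pd k (g j i) x := by
  have h : g i j =ᶠ[𝓝 x] g j i := (hU.eventually_mem hx).mono fun y hy => hg.symm i j y hy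
  rw [pd, pd, h.fderiv_eq]

theorem hasLineDerivOn_pd (hU : IsOpen U) (hg : IsMetric 1 g U) (k i j : Fin n) :
    HasLineDerivOn U (Pi.single k 1) (g i j) (pd k (g i j)) := fun _ hx =>
  (((hg.contDiff i j).contDiffAt (hU.mem_nhds hx)).differentiableAt
    one_ne_zero).hasFDerivAt.hasLineDerivAt _

theorem sum_mul_christoffel_s2 (hg : IsMetric 1 g U) (l i j : Fin n) {x : Fin n → ℝ} (hx : x ∈ U) :
    ∑ h, g l h x * Christoffel g h i j x
      = (1 / 2) * (pd i (g j l) x + pd j (g i l) x - pd l (g i j) x) := by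
  set v : Fin n → ℝ := fun k => pd i (g j k) x + pd j (g i k) x - pd k (g i j) x with hv
  have h1 : (fun h => Christoffel g h i j x) = (1 / 2 : ℝ) • ((matAt g x)⁻¹ *ᵥ v) := rfl
  have h2 : matAt g x *ᵥ (fun h => Christoffel g h i j x) = (1 / 2 : ℝ) • v := by
    rw [h1, mulVec_smul, mulVec_mulVec, mul_nonsing_inv _ (hg.inv x hx), one_mulVec]
  exact congrFun h2 l

/-- The metric is parallel with respect to its Levi-Civita connection. -/
theorem pd_matAt (hU : IsOpen U) (hg : IsMetric 1 g U) (k : Fin n) {x : Fin n → ℝ} (hx : x ∈ U) :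
    (of fun i j => pd k (g i j) x) = matAt g x * (of fun h i => Christoffel g h k i x)
      + (of fun h i => Christoffel g h k i x)ᵀ * matAt g x := by
  ext i j
  have h1 := hg.sum_mul_christoffel_s2 i k j hx
  have h2 := hg.sum_mul_christoffel_s2 j k i hx
  have h3 : ∑ h, Christoffel g h k i x * g h j x = ∑ h, g j h x * Christoffel g h k i x :=
    Finset.sum_congr rfl fun h _ => by rw [hg.symm h j x hx, mul_comm]
  simp only [of_apply, Matrix.add_apply, mul_apply, transpose_apply, matAt]
  rw [h3, h1, h2, hg.pd_symm_s2 hU k j i hx]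
  ring

theorem hasLineDerivOn_ginv (hU : IsOpen U) (hg : IsMetric 1 g U) (k i j : Fin n) :
    HasLineDerivOn U (Pi.single k 1) (ginv g i j) fun x =>
      -(∑ l, Christoffel g i k l x * ginv g l j x)
        - ∑ l, ginv g i l x * Christoffel g j k l x := fun x hx => by
  have h := HasDerivAt.matrix_inv (M := fun t : ℝ => matAt g (x + t • Pi.single k 1))
    (M' := of fun i j => pd k (g i j) x) (t := 0)
    (fun a b => hg.hasLineDerivOn_pd hU k a b x hx) (by simpa using hg.inv x hx) i j
  simp only [zero_smul, add_zero] at h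
  have hN := hg.inv x hx
  rw [hg.pd_matAt hU k hx, Matrix.mul_add, Matrix.add_mul, Matrix.mul_assoc _ _ (matAt g x)⁻¹,
    Matrix.mul_assoc _ _ (matAt g x)⁻¹, Matrix.mul_assoc _ _ (matAt g x)⁻¹,
    nonsing_inv_mul_cancel_left _ _ hN, mul_nonsing_inv_cancel_right _ _ hN, neg_add'] at h
  exact h

theorem hasLineDerivOn_det (hU : IsOpen U) (hg : IsMetric 1 g U) (k : Fin n) :
    HasLineDerivOn U (Pi.single k 1) (fun x => (matAt g x).det) fun x =>
      2 * (∑ h, Christoffel g h k h x) * (matAt g x).det := fun x hx => by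
  have h := HasDerivAt.matrix_det (M := fun t : ℝ => matAt g (x + t • Pi.single k 1))
    (M' := of fun i j => pd k (g i j) x) (t := 0)
    (fun a b => hg.hasLineDerivOn_pd hU k a b x hx)
  simp only [zero_smul, add_zero] at h
  rw [hg.pd_matAt hU k hx, Matrix.mul_add, trace_add, trace_mul_comm _ (_ * matAt g x),
    ← Matrix.mul_assoc, Matrix.mul_assoc _ _ (adjugate _), adjugate_mul, mul_adjugate, Matrix.smul_mul, Matrix.one_mul,
    Matrix.mul_smul, Matrix.mul_one, trace_smul, trace_smul, trace_transpose] at h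
  refine HasDerivAt.congr_deriv h ?_
  simp only [trace, diag, of_apply, smul_eq_mul]
  ring

end IsMetric

/-- The weight `|det g| ^ (1 / (n + 1))`. -/
def projectiveWeight (g : Fin n → Fin n → (Fin n → ℝ) → ℝ) (x : Fin n → ℝ) : ℝ :=
  Real.exp (Real.log (matAt g x).det / (n + 1))

theorem projectiveWeight_pow (hg : IsMetric 1 g U) {x : Fin n → ℝ} (hx : x ∈ U) :
    projectiveWeight g x ^ (n + 1) = |(matAt g x).det| := by
  rw [projectiveWeight, ← Real.exp_nat_mul, ← Real.exp_log_eq_abs (hg.inv x hx).ne_zero]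
  congr 1
  push_cast
  field_simp

theorem IsMetric.hasLineDerivOn_projectiveWeight (hU : IsOpen U) (hg : IsMetric 1 g U) (k : Fin n) :
    HasLineDerivOn U (Pi.single k 1) (projectiveWeight g) fun x =>
      2 / (n + 1) * (∑ h, Christoffel g h k h x) * projectiveWeight g x := fun x hx => by
  have hne : (matAt g (x + (0 : ℝ) • Pi.single k 1)).det ≠ 0 := by
    simpa using (hg.inv x hx).ne_zero
  have h := (((hg.hasLineDerivOn_det hU k x hx).log hne).div_const ((n : ℝ) + 1)).exp
  refine HasDerivAt.congr_deriv h ?_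
  simp only [zero_smul, add_zero] at hne ⊢
  rw [projectiveWeight]
  field_simp

theorem IsMetric.continuousOn_projectiveWeight (hg : IsMetric 1 g U) :
    ContinuousOn (projectiveWeight g) U :=
  (((continuous_id.matrix_det.comp_continuousOn hg.continuousOn_matAt).log fun x hx =>
    (hg.inv x hx).ne_zero).div_const _).rexp

/-- The weighted inverse metric `|det g| ^ (1 / (n + 1)) g^{ij}`, whose covariant derivative with
respect to any geodesically related metric is pure trace. -/
def weightedInverse (g : Fin n → Fin n → (Fin n → ℝ) → ℝ) (i j : Fin n) (x : Fin n → ℝ) : ℝ :=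
  projectiveWeight g x * ginv g i j x

theorem analyticOnNhd_christoffel (hg : IsMetric 1 g U) (hga : ∀ i j, AnalyticOnNhd ℝ (g i j) U)
    (h i j : Fin n) : AnalyticOnNhd ℝ (Christoffel g h i j) U := by
  have hpd : ∀ k i j, AnalyticOnNhd ℝ (pd k (g i j)) U := fun k i j x hx =>
    ((ContinuousLinearMap.apply ℝ ℝ (Pi.single k 1 : Fin n → ℝ)).analyticAt _).comp
      (hga i j x hx).fderiv
  intro x hx
  refine analyticAt_const.mul (Finset.analyticAt_fun_sum _ fun k _ => ?_)
  exact (AnalyticAt.matrix_inv (M := matAt g) (fun a b => hga a b x hx) (hg.inv x hx) h k).mul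
    (((hpd i j k x hx).add (hpd j i k x hx)).sub (hpd k i j x hx))

variable {gbar : Fin n → Fin n → (Fin n → ℝ) → ℝ} {ψ : Fin n → (Fin n → ℝ) → ℝ}

theorem GeodesicallyRelated.hasLineDerivOn_weightedInverse (hU : IsOpen U)
    (hgbar : IsMetric 1 gbar U) (hgeo : GeodesicallyRelated g gbar ψ U) (k i j : Fin n) :
    HasLineDerivOn U (Pi.single k 1) (weightedInverse gbar i j) fun x =>
      (if k = i then -∑ l, ψ l x * weightedInverse gbar l j x else 0)
        + (if k = j then -∑ l, ψ l x * weightedInverse gbar l i x else 0)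
        + (2 / (n + 1) * (∑ h, Christoffel g h k h x) * weightedInverse gbar i j x
          - ∑ l, Christoffel g i k l x * weightedInverse gbar l j x
          - ∑ l, Christoffel g j k l x * weightedInverse gbar i l x) := by
  refine ((hgbar.hasLineDerivOn_projectiveWeight hU k).mul
    (hgbar.hasLineDerivOn_ginv hU k i j)).congr hU (fun _ _ => rfl) fun x hx => ?_
  have htr : ∑ h, Christoffel gbar h k h x = ∑ h, Christoffel g h k h x + (n + 1) * ψ k x := by
    simp only [hgeo _ _ _ x hx, Finset.sum_add_distrib, if_true, mul_one, mul_ite, mul_zero,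
      Finset.sum_ite_eq', Finset.mem_univ, Finset.sum_const, Finset.card_univ, Fintype.card_fin,
      nsmul_eq_mul]
    ring
  have hcontr : ∀ a b, ∑ l, Christoffel gbar a k l x * ginv gbar l b x
      = ∑ l, Christoffel g a k l x * ginv gbar l b x + ψ k x * ginv gbar a b x
        + if k = a then ∑ l, ψ l x * ginv gbar l b x else 0 := by
    intro a b
    simp only [hgeo _ _ _ x hx, add_mul, Finset.sum_add_distrib]
    congr 1
    · simp
    · by_cases h : k = a
      · simp [h]
      · simp [h, Ne.symm h]
  have hright : ∑ l, ginv gbar i l x * Christoffel gbar j k l x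
      = ∑ l, Christoffel gbar j k l x * ginv gbar l i x :=
    Finset.sum_congr rfl fun l _ => by rw [hgbar.ginv_symm i l hx, mul_comm]
  have hsum : ∀ (c : Fin n → ℝ) b, ∑ l, c l * weightedInverse gbar l b x
      = projectiveWeight gbar x * ∑ l, c l * ginv gbar l b x := fun c b => by
    rw [Finset.mul_sum]
    exact Finset.sum_congr rfl fun l _ => by rw [weightedInverse]; ring
  have hsymm : ∑ l, Christoffel g j k l x * weightedInverse gbar i l x
      = ∑ l, Christoffel g j k l x * weightedInverse gbar l i x :=
    Finset.sum_congr rfl fun l _ => by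
      rw [weightedInverse, weightedInverse, hgbar.ginv_symm i l hx]
  have hn : (n : ℝ) + 1 ≠ 0 := by positivity
  simp only [hright, hcontr, htr, hsymm, hsum, hgbar.ginv_symm j i hx]
  rw [weightedInverse]
  split_ifs <;> field_simp <;> ring

theorem IsMetric.analyticOnNhd_of_weightedInverse (hU : IsOpen U) (hg : IsMetric 1 g U)
    (hσ : ∀ i j, AnalyticOnNhd ℝ (weightedInverse g i j) U) (i j : Fin n) :
    AnalyticOnNhd ℝ (g i j) U := by
  intro x hx
  have hmat : ∀ y, matAt (weightedInverse g) y = projectiveWeight g y • (matAt g y)⁻¹ :=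
    fun y => rfl
  have hpos : ∀ y, 0 < projectiveWeight g y := fun y => Real.exp_pos _
  have hdet : ∀ y ∈ U, |(matAt (weightedInverse g) y).det| = (projectiveWeight g y)⁻¹ := by
    intro y hy
    have hD := (hg.inv y hy).ne_zero
    rw [hmat, det_smul, det_nonsing_inv, Ring.inverse_eq_inv', abs_mul, abs_inv,
      ← projectiveWeight_pow hg hy, abs_of_pos (pow_pos (hpos y) _), Fintype.card_fin]
    have := (hpos y).ne'
    field_simp
    ring
  have hunit : IsUnit (matAt (weightedInverse g) x).det :=
    isUnit_iff_ne_zero.2 <| abs_ne_zero.1 <| by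
      rw [hdet x hx]
      exact (inv_pos.2 (hpos x)).ne'
  have hA : AnalyticAt ℝ (fun y => (|(matAt (weightedInverse g) y).det|)⁻¹
      * (matAt (weightedInverse g) y)⁻¹ i j) x := by
    have habs : AnalyticAt ℝ (fun t : ℝ => |t|) (matAt (weightedInverse g) x).det :=
      analyticAt_abs hunit.ne_zero
    have hd : AnalyticAt ℝ (fun y => (matAt (weightedInverse g) y).det) x :=
      AnalyticAt.matrix_det fun a b => hσ a b x hx
    exact ((habs.comp_of_eq hd rfl).inv
      (abs_ne_zero.2 hunit.ne_zero)).mul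
      (AnalyticAt.matrix_inv (fun a b => hσ a b x hx) hunit i j)
  refine hA.congr ((hU.eventually_mem hx).mono fun y hy => ?_)
  have hinv : (projectiveWeight g y • (matAt g y)⁻¹)⁻¹ = (projectiveWeight g y)⁻¹ • matAt g y :=
    inv_eq_right_inv <| by
      rw [smul_mul_smul_comm, mul_inv_cancel₀ (hpos y).ne', nonsing_inv_mul _ (hg.inv y hy),
        one_smul]
  beta_reduce
  rw [hdet y hy, hmat, hinv, inv_inv, Matrix.smul_apply, smul_eq_mul,
    mul_inv_cancel_left₀ (hpos y).ne']
  rfl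

end GeodesicMappings

/-- Geodesic mappings preserve real-analyticity: if `g` is real-analytic and `ḡ ∈ C^1`
are geodesically related via a continuous 1-form `ψ` on an open set `U ⊆ ℝⁿ` (`n ≥ 2`),
then `ḡ` is real-analytic. -/
theorem geodesic_mapping_preserves_analytic
    {n : ℕ} (hn : 2 ≤ n) (U : Set (Fin n → ℝ)) (hU : IsOpen U)
    (g gbar : Fin n → Fin n → (Fin n → ℝ) → ℝ)
    (hg : IsMetric 1 g U) (hga : ∀ i j, AnalyticOnNhd ℝ (g i j) U)
    (hgbar : IsMetric 1 gbar U)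
    (ψ : Fin n → (Fin n → ℝ) → ℝ) (hψ : ∀ i, ContinuousOn (ψ i) U)
    (hgeo : GeodesicallyRelated g gbar ψ U) :
    ∀ i j, AnalyticOnNhd ℝ (gbar i j) U := by
  have cσ : ∀ i j, ContinuousOn (weightedInverse gbar i j) U := fun i j =>
    hgbar.continuousOn_projectiveWeight.mul <| continuousOn_pi.1
      (continuousOn_pi.1 (ContinuousOn.matrix_inv hgbar.continuousOn_matAt hgbar.inv) i) j
  have hΓ := analyticOnNhd_christoffel hg hga
  refine hgbar.analyticOnNhd_of_weightedInverse hU <|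
    analyticOnNhd_of_metrizability_system hn hU cσ
      (fun j => (continuousOn_finsetSum _ fun l _ => (hψ l).mul (cσ l j)).neg) (fun k i j => ?_)
      (hgeo.hasLineDerivOn_weightedInverse hU hgbar)
  have hmem : ∀ a b, AnalyticSpan U
      (Set.range fun p : Fin n × Fin n => weightedInverse gbar p.1 p.2) (weightedInverse gbar a b) :=
    fun a b => .of ⟨(a, b), rfl⟩
  refine ((AnalyticSpan.mul ?_ (hmem i j)).sub (.sum fun l _ => .mul (hΓ i k l) (hmem l j))).sub
    (.sum fun l _ => .mul (hΓ j k l) (hmem i l))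
  exact analyticOnNhd_const.mul fun x hx => Finset.analyticAt_fun_sum _ fun h _ => hΓ h k h x hx
end
end
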